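/- arXiv:1805.01997 — 6 statements merged into one kernel-verified Lean document; each statement's English description precedes it below -/
import Mathlib

section
/- Let n ≥ 1 and let K₁, …, Kₙ be nonempty compact connected subsets of ℝⁿ, each containing the origin. Assume that for each i there is a point eᵢ ∈ Kᵢ such that the vectors e₁, …, eₙ are linearly independent. Then the Minkowski sum K₁ + ⋯ + Kₙ has non-empty interior in ℝⁿ. -/
/-- The Minkowski sum `K 0 + ⋯ + K (n-1)` of a family of sets. -/
def familySum {n : ℕ} {X : Type*} [AddCommMonoid X] (K : Fin n → Set X) : Set X :=
  {x | ∃ f : Fin n → X, (∀ i, f i ∈ K i) ∧ ∑ i, f i = x}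

open MeasureTheory Set Filter Topology Metric

/-- The character `x ↦ exp (i ⟨θ, x⟩)` of `ℝ^ι`. -/
noncomputable def planeWave {ι : Type*} [Fintype ι] (θ x : ι → ℝ) : ℂ :=
  Complex.exp (((∑ j, θ j * x j : ℝ) : ℂ) * Complex.I)

/-- A finite measure on pairs (position, velocity) that is carried by positions in `U` and
integrates the differentials of the coordinates and of the characters like a path in `U` from `p`
to `q` does. -/
structure IsPathMeasure {ι : Type*} [Fintype ι] (ν : Measure ((ι → ℝ) × (ι → ℝ)))
    (U : Set (ι → ℝ)) (p q : ι → ℝ) : Prop where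
  finite : IsFiniteMeasure ν
  mem : ∀ᵐ z ∂ν, z.1 ∈ U
  integrable : ∀ j, Integrable (fun z => (z.2 j : ℂ)) ν
  integral_coord : ∀ j, ∫ z, (z.2 j : ℂ) ∂ν = q j - p j
  integral_planeWave : ∀ θ : ι → ℝ,
    ∫ z, planeWave θ z.1 * ((∑ j, θ j * z.2 j : ℝ) : ℂ) * Complex.I ∂ν =
      planeWave θ q - planeWave θ p

section

variable {ι : Type*} [Fintype ι]

theorem continuous_planeWave (θ : ι → ℝ) : Continuous (planeWave θ) := by
  unfold planeWave
  fun_prop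

theorem norm_planeWave (θ x : ι → ℝ) : ‖planeWave θ x‖ = 1 :=
  Complex.norm_exp_ofReal_mul_I _

theorem planeWave_sum {κ : Type*} [Fintype κ] (θ : ι → ℝ) (x : κ → ι → ℝ) :
    planeWave θ (∑ i, x i) = ∏ i, planeWave θ (x i) := by
  simp only [planeWave, ← Complex.exp_sum, ← Finset.sum_mul, ← Complex.ofReal_sum,
    Finset.sum_apply, Finset.mul_sum]
  rw [Finset.sum_comm]

theorem planeWave_zero_left (x : ι → ℝ) : planeWave 0 x = 1 := by
  simp [planeWave]

theorem planeWave_zero_right (θ : ι → ℝ) : planeWave θ 0 = 1 := by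
  simp [planeWave]

theorem planeWave_single [DecidableEq ι] (k : ι → ℤ) (i : ι) :
    planeWave (fun j => 2 * Real.pi * k j) (Pi.single i 1) = 1 := by
  rw [planeWave, Complex.exp_eq_one_iff]
  refine ⟨k i, ?_⟩
  simp [Pi.single_apply]
  ring

theorem IsPathMeasure.integrable_mul {ν : Measure ((ι → ℝ) × (ι → ℝ))} {U : Set (ι → ℝ)}
    {p q : ι → ℝ} (h : IsPathMeasure ν U p q) (θ : ι → ℝ) (j : ι) :
    Integrable (fun z => planeWave θ z.1 * (z.2 j : ℂ)) ν :=
  (h.integrable j).bdd_mul (c := 1)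
    ((continuous_planeWave θ).comp continuous_fst).aestronglyMeasurable
    (Eventually.of_forall fun z => (norm_planeWave θ z.1).le)

theorem IsPathMeasure.integrable_differential {ν : Measure ((ι → ℝ) × (ι → ℝ))}
    {U : Set (ι → ℝ)} {p q : ι → ℝ} (h : IsPathMeasure ν U p q) (θ : ι → ℝ) :
    Integrable (fun z => planeWave θ z.1 * ((∑ j, θ j * z.2 j : ℝ) : ℂ) * Complex.I) ν := by
  have := (integrable_finsetSum Finset.univ fun j _ =>
    (h.integrable_mul θ j).const_mul (θ j : ℂ)).mul_const Complex.I
  refine this.congr (Eventually.of_forall fun z => ?_)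
  simp only [Complex.ofReal_sum, Complex.ofReal_mul, Finset.mul_sum]
  congr 1
  exact Finset.sum_congr rfl fun j _ => by ring

theorem IsPathMeasure.trans {ν₁ ν₂ : Measure ((ι → ℝ) × (ι → ℝ))} {U : Set (ι → ℝ)}
    {p q r : ι → ℝ} (h₁ : IsPathMeasure ν₁ U p q) (h₂ : IsPathMeasure ν₂ U q r) :
    IsPathMeasure (ν₁ + ν₂) U p r where
  finite := by
    have := h₁.finite
    have := h₂.finite
    infer_instance
  mem := ae_add_measure_iff.2 ⟨h₁.mem, h₂.mem⟩
  integrable j := (h₁.integrable j).add_measure (h₂.integrable j)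
  integral_coord j := by
    rw [integral_add_measure (h₁.integrable j) (h₂.integrable j), h₁.integral_coord,
      h₂.integral_coord]
    ring
  integral_planeWave θ := by
    rw [integral_add_measure (h₁.integrable_differential θ) (h₂.integrable_differential θ),
      h₁.integral_planeWave, h₂.integral_planeWave]
    ring

theorem exists_isPathMeasure_of_segment_subset {U : Set (ι → ℝ)} (hUo : IsOpen U)
    {p q : ι → ℝ} (hU : segment ℝ p q ⊆ U) : ∃ ν, IsPathMeasure ν U p q := by
  set γ : ℝ → (ι → ℝ) × (ι → ℝ) := fun s => (p + s • (q - p), q - p) with hγ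
  have hγc : Continuous γ := by fun_prop
  have hcoord (j : ι) : Continuous fun z : (ι → ℝ) × (ι → ℝ) => (z.2 j : ℂ) := by fun_prop
  have hwave (θ : ι → ℝ) : Continuous fun z : (ι → ℝ) × (ι → ℝ) =>
      planeWave θ z.1 * ((∑ j, θ j * z.2 j : ℝ) : ℂ) * Complex.I := by
    have := (continuous_planeWave θ).comp
      (continuous_fst : Continuous fun z : (ι → ℝ) × (ι → ℝ) => z.1)
    simp only [Function.comp_def] at this
    fun_prop
  have hm := hγc.aemeasurable (μ := volume.restrict (Ioc (0 : ℝ) 1))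
  refine ⟨(volume.restrict (Ioc (0 : ℝ) 1)).map γ, ?_, ?_, fun j => ?_, fun j => ?_, fun θ => ?_⟩
  · infer_instance
  · refine (ae_map_iff hm (hUo.measurableSet.preimage measurable_fst)).2 ?_
    filter_upwards [ae_restrict_mem measurableSet_Ioc] with s hs
    refine hU ?_
    rw [segment_eq_image']
    exact mem_image_of_mem _ ⟨hs.1.le, hs.2⟩
  · rw [integrable_map_measure (hcoord j).aestronglyMeasurable hm]
    exact integrable_const ((q j - p j : ℝ) : ℂ)
  · rw [integral_map hm (hcoord j).aestronglyMeasurable]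
    simp [hγ]
  · rw [integral_map hm (hwave θ).aestronglyMeasurable,
      ← intervalIntegral.integral_of_le zero_le_one,
      intervalIntegral.integral_eq_sub_of_hasDerivAt (f := fun s => planeWave θ (γ s).1)]
    · simp [hγ]
    · intro s _
      have h1 : HasDerivAt (fun s : ℝ => ∑ j, θ j * (γ s).1 j) (∑ j, θ j * (γ s).2 j) s := by
        refine HasDerivAt.fun_sum fun j _ => ?_
        simpa [hγ] using (((hasDerivAt_id s).mul_const (q j - p j)).const_add (p j)).const_mul (θ j)
      have h2 := (h1.ofReal_comp.mul_const Complex.I).cexp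
      simpa only [planeWave, mul_assoc] using h2
    · exact ((hwave θ).comp hγc).intervalIntegrable _ _

theorem IsPreconnected.exists_isPathMeasure {K : Set (ι → ℝ)} (hK : IsPreconnected K) {ε : ℝ}
    (hε : 0 < ε) {p q : ι → ℝ} (hp : p ∈ K) (hq : q ∈ K) :
    ∃ ν, IsPathMeasure ν (thickening ε K) p q := by
  refine hK.induction₂' (fun p q => ∃ ν, IsPathMeasure ν (thickening ε K) p q) (fun x hx => ?_)
    (fun x y z _ _ _ ⟨ν₁, h₁⟩ ⟨ν₂, h₂⟩ => ⟨ν₁ + ν₂, h₁.trans h₂⟩) hp hq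
  filter_upwards [mem_nhdsWithin_of_mem_nhds (ball_mem_nhds x hε)] with y hy
  have hsub : segment ℝ x y ⊆ thickening ε K :=
    ((convex_ball x ε).segment_subset (mem_ball_self hε) hy).trans (ball_subset_thickening hx ε)
  exact ⟨exists_isPathMeasure_of_segment_subset isOpen_thickening hsub,
    exists_isPathMeasure_of_segment_subset isOpen_thickening (segment_symm ℝ x y ▸ hsub)⟩

theorem cos_sq_pow_eq_sum (N : ℕ) (s : ℝ) :
    (((Real.cos (Real.pi * s) ^ 2) ^ N : ℝ) : ℂ) = ∑ m ∈ Finset.range (2 * N + 1),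
      ((2 * N).choose m / 4 ^ N : ℂ) *
        Complex.exp (((2 * Real.pi * ((m - N : ℤ) : ℝ) * s : ℝ) : ℂ) * Complex.I) := by
  rw [← pow_mul, Complex.ofReal_pow, Complex.ofReal_cos, Complex.cos, div_pow, add_pow, pow_mul,
    Finset.sum_div]
  refine Finset.sum_congr rfl fun m hm => ?_
  have hm' : m ≤ 2 * N := Nat.lt_succ_iff.1 (Finset.mem_range.1 hm)
  rw [← Complex.exp_nat_mul, ← Complex.exp_nat_mul, ← Complex.exp_add, Nat.cast_sub hm']
  push_cast
  rw [show (2 : ℂ) ^ 2 = 4 by norm_num, mul_comm, mul_div_right_comm]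
  congr 2
  ring

/-- A nonnegative trigonometric polynomial that attains its maximum `1` exactly on `y + ℤ^ι`. -/
noncomputable def latticePeak (y x : ι → ℝ) : ℝ :=
  ∏ j, Real.cos (Real.pi * (x j - y j)) ^ 2

theorem continuous_latticePeak (y : ι → ℝ) : Continuous (latticePeak y) := by
  unfold latticePeak
  fun_prop

theorem latticePeak_nonneg (y x : ι → ℝ) : 0 ≤ latticePeak y x :=
  Finset.prod_nonneg fun _ _ => sq_nonneg _

theorem latticePeak_lt_one {y x : ι → ℝ} (h : ∀ k : ι → ℤ, y ≠ x + fun j => (k j : ℝ)) :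
    latticePeak y x < 1 := by
  classical
  have hle (j : ι) : Real.cos (Real.pi * (x j - y j)) ^ 2 ≤ 1 := Real.cos_sq_le_one _
  by_contra! h1
  have heq (j : ι) : Real.cos (Real.pi * (x j - y j)) ^ 2 = 1 := by
    refine (hle j).antisymm (h1.trans ?_)
    rw [latticePeak, ← Finset.mul_prod_erase _ _ (Finset.mem_univ j)]
    exact mul_le_of_le_one_right (sq_nonneg _)
      (Finset.prod_le_one (fun _ _ => sq_nonneg _) fun i _ => hle i)
  have hinteg (j : ι) : ∃ m : ℤ, (m : ℝ) = y j - x j := by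
    have hs : Real.sin (Real.pi * (x j - y j)) = 0 := by
      have := Real.sin_sq_add_cos_sq (Real.pi * (x j - y j))
      rw [heq j] at this
      exact pow_eq_zero_iff two_ne_zero |>.1 (by linarith)
    obtain ⟨m, hm⟩ := Real.sin_eq_zero_iff.1 hs
    refine ⟨-m, ?_⟩
    have := mul_right_cancel₀ Real.pi_ne_zero (hm.trans (mul_comm _ _))
    push_cast
    linarith
  choose k hk using hinteg
  refine h k (funext fun j => ?_)
  simp [hk]

variable [DecidableEq ι]

theorem integrable_det_pi {Ω : ι → Type*} {mΩ : ∀ i, MeasurableSpace (Ω i)}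
    {μ : ∀ i, Measure (Ω i)} [∀ i, SigmaFinite (μ i)] {g : ∀ i, ι → Ω i → ℂ}
    (hg : ∀ i j, Integrable (g i j) (μ i)) :
    Integrable (fun z : ∀ i, Ω i => (Matrix.of fun j i => g i j (z i)).det) (Measure.pi μ) := by
  simp only [Matrix.det_apply', Matrix.of_apply]
  exact integrable_finsetSum _ fun σ _ =>
    (Integrable.fintype_prod_dep fun i => hg i (σ i)).const_mul _

theorem integral_det_pi {Ω : ι → Type*} {mΩ : ∀ i, MeasurableSpace (Ω i)}
    {μ : ∀ i, Measure (Ω i)} [∀ i, SigmaFinite (μ i)] {g : ∀ i, ι → Ω i → ℂ}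
    (hg : ∀ i j, Integrable (g i j) (μ i)) :
    ∫ z : ∀ i, Ω i, (Matrix.of fun j i => g i j (z i)).det ∂Measure.pi μ =
      (Matrix.of fun j i => ∫ w, g i j w ∂μ i).det := by
  simp only [Matrix.det_apply', Matrix.of_apply]
  rw [integral_finsetSum _ fun σ _ =>
    (Integrable.fintype_prod_dep fun i => hg i (σ i)).const_mul _]
  refine Finset.sum_congr rfl fun σ _ => ?_
  rw [integral_const_mul, integral_fintype_prod_eq_prod (f := fun i w => g i (σ i) w)]

theorem integral_planeWave_mul_det {ν : ι → Measure ((ι → ℝ) × (ι → ℝ))}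
    {U : ι → Set (ι → ℝ)} (h : ∀ i, IsPathMeasure (ν i) (U i) 0 (Pi.single i 1)) (k : ι → ℤ) :
    ∫ z : ι → (ι → ℝ) × (ι → ℝ), planeWave (fun j => 2 * Real.pi * k j) (∑ i, (z i).1) *
      (Matrix.of fun j i => ((z i).2 j : ℂ)).det ∂Measure.pi ν = if k = 0 then 1 else 0 := by
  have := fun i => (h i).finite
  set θ : ι → ℝ := fun j => 2 * Real.pi * k j with hθ
  have hdet (z : ι → (ι → ℝ) × (ι → ℝ)) : planeWave θ (∑ i, (z i).1) *
      (Matrix.of fun j i => ((z i).2 j : ℂ)).det =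
      (Matrix.of fun j i => planeWave θ (z i).1 * ((z i).2 j : ℂ)).det := by
    rw [planeWave_sum]
    exact (Matrix.det_mul_row (fun i => planeWave θ (z i).1)
      (Matrix.of fun j i => ((z i).2 j : ℂ))).symm
  simp_rw [hdet]
  refine (integral_det_pi (Ω := fun _ => (ι → ℝ) × (ι → ℝ)) (μ := ν)
    (g := fun _ j w => planeWave θ w.1 * (w.2 j : ℂ))
    fun i j => (h i).integrable_mul θ j).trans ?_
  split_ifs with hk
  · have hθ0 : θ = 0 := by ext; simp [hθ, hk]
    rw [← Matrix.det_one (n := ι)]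
    congr 1
    ext j i
    simp only [Matrix.of_apply, hθ0, planeWave_zero_left, one_mul, (h i).integral_coord]
    simp only [Pi.single_apply, Matrix.one_apply, Pi.zero_apply, Complex.ofReal_zero, sub_zero]
    split_ifs <;> simp
  · rw [← Matrix.exists_vecMul_eq_zero_iff]
    refine ⟨fun j => (θ j : ℂ), fun h0 => hk ?_, ?_⟩
    · ext j
      have := congrFun h0 j
      simpa [hθ, Real.pi_ne_zero] using this
    · ext i
      have hi := (h i).integral_planeWave θ
      rw [planeWave_single, planeWave_zero_right, sub_self, integral_mul_const] at hi
      have hi' := (mul_eq_zero.1 hi).resolve_right Complex.I_ne_zero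
      simp only [Matrix.vecMul, dotProduct, Matrix.of_apply, Pi.zero_apply, ← integral_const_mul]
      rw [← integral_finsetSum _ fun j _ => ((h i).integrable_mul θ j).const_mul _, ← hi']
      refine integral_congr_ae (Eventually.of_forall fun z => ?_)
      simp only [Complex.ofReal_sum, Complex.ofReal_mul, Finset.mul_sum]
      exact Finset.sum_congr rfl fun j _ => by ring

theorem latticePeak_pow_eq_sum (y x : ι → ℝ) (N : ℕ) :
    ((latticePeak y x ^ N : ℝ) : ℂ) =
      ∑ m ∈ Fintype.piFinset fun _ : ι => Finset.range (2 * N + 1),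
        (∏ j, ((2 * N).choose (m j) / 4 ^ N : ℂ)) *
          planeWave (fun j => 2 * Real.pi * ((m j - N : ℤ) : ℝ)) (-y) *
          planeWave (fun j => 2 * Real.pi * ((m j - N : ℤ) : ℝ)) x := by
  rw [latticePeak, ← Finset.prod_pow, Complex.ofReal_prod]
  simp_rw [cos_sq_pow_eq_sum]
  rw [Finset.prod_univ_sum]
  refine Finset.sum_congr rfl fun m _ => ?_
  rw [Finset.prod_mul_distrib, ← Complex.exp_sum, mul_assoc, planeWave, planeWave,
    ← Complex.exp_add, ← Finset.sum_mul, ← Complex.ofReal_sum, ← add_mul, ← Complex.ofReal_add,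
    ← Finset.sum_add_distrib]
  congr 6
  ext j
  simp only [Pi.neg_apply]
  ring

theorem integral_latticePeak_pow_mul_det {ν : ι → Measure ((ι → ℝ) × (ι → ℝ))}
    {U : ι → Set (ι → ℝ)} (h : ∀ i, IsPathMeasure (ν i) (U i) 0 (Pi.single i 1))
    (hdet : Integrable (fun z : ι → (ι → ℝ) × (ι → ℝ) =>
      (Matrix.of fun j i => ((z i).2 j : ℂ)).det) (Measure.pi ν))
    (y : ι → ℝ) (N : ℕ) :
    ∫ z : ι → (ι → ℝ) × (ι → ℝ), ((latticePeak y (∑ i, (z i).1) ^ N : ℝ) : ℂ) *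
      (Matrix.of fun j i => ((z i).2 j : ℂ)).det ∂Measure.pi ν =
        (N.centralBinom / 4 ^ N : ℂ) ^ Fintype.card ι := by
  simp_rw [latticePeak_pow_eq_sum, Finset.sum_mul, mul_assoc (G := ℂ)]
  rw [integral_finsetSum]
  · have hinteg (m : ι → ℕ) := integral_planeWave_mul_det h fun j => (m j - N : ℤ)
    simp_rw [integral_const_mul, hinteg]
    rw [Finset.sum_eq_single fun _ => N]
    · simp only [sub_self]
      rw [if_pos (show (fun _ : ι => (0 : ℤ)) = 0 from rfl)]
      simp [planeWave, Nat.centralBinom, div_pow]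
    · intro m _ hm
      rw [if_neg, mul_zero, mul_zero]
      intro h0
      refine hm (funext fun j => ?_)
      have := congrFun h0 j
      simp only [Pi.zero_apply] at this
      omega
    · intro hN
      refine (hN ?_).elim
      simp only [Fintype.mem_piFinset, Finset.mem_range]
      omega
  · intro m _
    refine ((hdet.bdd_mul (c := 1) ?_ ?_).const_mul _).const_mul _
    · exact ((continuous_planeWave _).comp (by fun_prop)).aestronglyMeasurable
    · exact Eventually.of_forall fun z => (norm_planeWave _ _).le

/-- The integer translates of a sum of continua joining `0` to the standard basis vectors cover
`ℝ^ι`. -/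
theorem exists_sum_add_int_eq {K : ι → Set (ι → ℝ)} (hcomp : ∀ i, IsCompact (K i))
    (hconn : ∀ i, IsPreconnected (K i)) (h0 : ∀ i, 0 ∈ K i) (h1 : ∀ i, Pi.single i 1 ∈ K i)
    (y : ι → ℝ) :
    ∃ x : ι → ι → ℝ, (∀ i, x i ∈ K i) ∧ ∃ k : ι → ℤ, y = ∑ i, x i + fun j => (k j : ℝ) := by
  by_contra! hy
  set G : (ι → ι → ℝ) → ℝ := fun x => latticePeak y (∑ i, x i)
  have hGc : Continuous G := (continuous_latticePeak y).comp (by fun_prop)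
  have hKc : IsCompact (univ.pi K) := isCompact_univ_pi hcomp
  obtain ⟨x₀, hx₀, hmax⟩ := hKc.exists_isMaxOn ⟨0, fun i _ => h0 i⟩ hGc.continuousOn
  obtain ⟨r, hr, hr1⟩ := exists_between
    (latticePeak_lt_one (hy x₀ fun i => hx₀ i (mem_univ i)) : G x₀ < 1)
  have hr0 : 0 ≤ r := (latticePeak_nonneg _ _).trans hr.le
  obtain ⟨ε, hε, hsub⟩ := hKc.exists_thickening_subset_open (isOpen_Iio.preimage hGc)
    (fun x hx => (hmax hx).trans_lt hr : univ.pi K ⊆ G ⁻¹' Iio r)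
  choose ν hν using fun i => (hconn i).exists_isPathMeasure hε (h0 i) (h1 i)
  have := fun i => (hν i).finite
  have hdet : Integrable (fun z : ι → (ι → ℝ) × (ι → ℝ) =>
      (Matrix.of fun j i => ((z i).2 j : ℂ)).det) (Measure.pi ν) :=
    integrable_det_pi (Ω := fun _ => (ι → ℝ) × (ι → ℝ)) (μ := ν)
      (g := fun _ j w => (w.2 j : ℂ)) fun i j => (hν i).integrable j
  have hmem : ∀ᵐ z ∂Measure.pi ν, G (fun i => (z i).1) < r := by
    filter_upwards [eventually_all.2 fun i =>
      Measure.tendsto_eval_ae_ae.eventually (hν i).mem] with z hz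
    refine hsub (mem_thickening_iff.2 ?_)
    choose w hw hzw using fun i => mem_thickening_iff.1 (hz i)
    exact ⟨w, fun i _ => hw i, (dist_pi_lt_iff hε).2 hzw⟩
  set d := Fintype.card ι
  set M := ∫ z : ι → (ι → ℝ) × (ι → ℝ), ‖(Matrix.of fun j i => ((z i).2 j : ℂ)).det‖
    ∂Measure.pi ν with hM
  have hbound (N : ℕ) : (N.centralBinom / 4 ^ N : ℝ) ^ d ≤ r ^ N * M := by
    have hI := congrArg norm (integral_latticePeak_pow_mul_det hν hdet y N)
    rw [norm_pow, norm_div, norm_pow, Complex.norm_natCast, Complex.norm_ofNat] at hI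
    rw [← hI, hM, ← integral_const_mul]
    refine norm_integral_le_of_norm_le (hdet.norm.const_mul _) ?_
    filter_upwards [hmem] with z hz
    rw [norm_mul, Complex.norm_real, Real.norm_of_nonneg (pow_nonneg (latticePeak_nonneg _ _) _)]
    gcongr
    exact latticePeak_nonneg _ _
  have hlim : Tendsto (fun N : ℕ => 2 ^ d * M * ((N : ℝ) ^ d * r ^ N)) atTop (𝓝 0) := by
    simpa using (tendsto_pow_const_mul_const_pow_of_lt_one d hr0 hr1).const_mul (2 ^ d * M)
  obtain ⟨N, hN, hN0⟩ := ((hlim.eventually_lt_const one_pos).and (eventually_gt_atTop 0)).exists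
  refine hN.not_ge ?_
  have hc : (1 : ℝ) ≤ 2 * N * (N.centralBinom / 4 ^ N) := by
    rw [← mul_div_assoc, one_le_div (by positivity)]
    exact_mod_cast Nat.four_pow_le_two_mul_self_mul_centralBinom N hN0
  calc (1 : ℝ) ≤ (2 * N * (N.centralBinom / 4 ^ N)) ^ d := one_le_pow₀ hc
    _ = (2 * N) ^ d * (N.centralBinom / 4 ^ N : ℝ) ^ d := mul_pow _ _ _
    _ ≤ (2 * N) ^ d * (r ^ N * M) := by gcongr; exact hbound N
    _ = 2 ^ d * M * (N ^ d * r ^ N) := by rw [mul_pow]; ring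

end

theorem isCompact_familySum {n : ℕ} {X : Type*} [AddCommMonoid X] [TopologicalSpace X]
    [ContinuousAdd X] {K : Fin n → Set X} (hcomp : ∀ i, IsCompact (K i)) :
    IsCompact (familySum K) := by
  have : familySum K = (fun f : Fin n → X => ∑ i, f i) '' univ.pi K := by
    ext x
    simp [familySum]
  rw [this]
  exact (isCompact_univ_pi hcomp).image (by fun_prop)

theorem image_familySum {n : ℕ} {X Y F : Type*} [AddCommMonoid X] [AddCommMonoid Y]
    [FunLike F X Y] [AddMonoidHomClass F X Y] (L : F) (K : Fin n → Set X) :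
    L '' familySum K = familySum fun i => L '' K i := by
  ext y
  constructor
  · rintro ⟨_, ⟨f, hf, rfl⟩, rfl⟩
    exact ⟨fun i => L (f i), fun i => mem_image_of_mem L (hf i), (map_sum L f _).symm⟩
  · rintro ⟨g, hg, rfl⟩
    choose f hf hfg using hg
    exact ⟨∑ i, f i, ⟨f, hf, rfl⟩, by simp [hfg]⟩

theorem interior_familySum_nonempty_of_single_mem {n : ℕ} {K : Fin n → Set (Fin n → ℝ)}
    (hcomp : ∀ i, IsCompact (K i)) (hconn : ∀ i, IsPreconnected (K i)) (h0 : ∀ i, 0 ∈ K i)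
    (h1 : ∀ i, Pi.single i 1 ∈ K i) : (interior (familySum K)).Nonempty := by
  obtain ⟨k, hk⟩ := nonempty_interior_of_iUnion_of_closed
    (f := fun k : Fin n → ℤ => Homeomorph.addRight (fun j => (k j : ℝ)) '' familySum K)
    (fun k => ((isCompact_familySum hcomp).image (Homeomorph.continuous _)).isClosed) <| by
      refine eq_univ_of_forall fun y => mem_iUnion.2 ?_
      obtain ⟨x, hx, k, rfl⟩ := exists_sum_add_int_eq hcomp hconn h0 h1 y
      exact ⟨k, _, ⟨x, hx, rfl⟩, rfl⟩
  rwa [← Homeomorph.image_interior, image_nonempty] at hk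

theorem interior_nonempty_of_sum_of_continua
    {n : ℕ} (hn : 0 < n) (K : Fin n → Set (Fin n → ℝ))
    (hne : ∀ i, (K i).Nonempty)
    (hcomp : ∀ i, IsCompact (K i))
    (hconn : ∀ i, IsConnected (K i))
    (h0 : ∀ i, (0 : Fin n → ℝ) ∈ K i)
    (e : Fin n → (Fin n → ℝ)) (he : ∀ i, e i ∈ K i)
    (hind : LinearIndependent ℝ e) :
    (interior (familySum K)).Nonempty := by
  let b := basisOfLinearIndependentOfCardEqFinrank' e hind (by simp)
  let L := b.equivFun.toContinuousLinearEquiv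
  have hL (i : Fin n) : L (e i) = Pi.single i 1 := by
    have : e i = b i := by simp [b]
    rw [this]
    ext j
    simp [L, Pi.single_apply, eq_comm]
  have := interior_familySum_nonempty_of_single_mem (K := fun i => L '' K i)
    (fun i => (hcomp i).image L.continuous)
    (fun i => (hconn i).isPreconnected.image L L.continuous.continuousOn)
    (fun i => ⟨0, h0 i, map_zero L⟩) (fun i => ⟨e i, he i, hL i⟩)
  rwa [← image_familySum, ← L.coe_toHomeomorph, ← Homeomorph.image_interior,
    image_nonempty] at this
end

section
/- Let n ≥ 1 and let K₁, …, Kₙ be nonempty compact connected subsets of ℝⁿ, each containing the origin. Assume that for each i there is a point eᵢ ∈ Kᵢ such that the vectors e₁, …, eₙ are linearly independent. Then the Lebesgue measure of the Minkowski sum K₁ + ⋯ + Kₙ is at least the volume of the parallelotope P = [0,1]·e₁ + ⋯ + [0,1]·eₙ, i.e., at least the absolute value of the determinant of the matrix whose columns are e₁, …, eₙ. -/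
open MeasureTheory

open Set Topology UnitAddTorus

/-- In a connected metric space, any two points are joined by a finite `ε`-chain; the chain is
recorded through its steps `x j, x j + v j` and the telescoping of sums along it. -/
theorem IsPreconnected.exists_telescoping_steps {E : Type*} [NormedAddCommGroup E] {K : Set E}
    (hK : IsPreconnected K) {a b : E} (ha : a ∈ K) (hb : b ∈ K) {ε : ℝ} (hε : 0 < ε) :
    ∃ (N : ℕ) (x v : Fin N → E), (∀ j, x j ∈ K) ∧ (∀ j, ‖v j‖ < ε) ∧
      ∀ F : E → ℂ, ∑ j, (F (x j + v j) - F (x j)) = F b - F a := by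
  have : PreconnectedSpace K := Subtype.preconnectedSpace hK
  let R : K → K → Prop := fun p q => dist p q < ε
  have hclopen : IsClopen {q | Relation.ReflTransGen R ⟨a, ha⟩ q} := by
    constructor
    · rw [← isOpen_compl_iff, Metric.isOpen_iff]
      refine fun p hp => ⟨ε, hε, fun q hq hq' => hp ?_⟩
      exact Relation.ReflTransGen.tail hq' (by simpa [R] using hq)
    · rw [Metric.isOpen_iff]
      refine fun p hp => ⟨ε, hε, fun q hq => ?_⟩
      exact Relation.ReflTransGen.tail hp (by simpa [R, dist_comm] using hq)
  have huniv := hclopen.eq_univ ⟨⟨a, ha⟩, Relation.ReflTransGen.refl⟩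
  have hab : Relation.ReflTransGen R ⟨a, ha⟩ ⟨b, hb⟩ := huniv.ge (mem_univ _)
  suffices h : ∀ q : K, Relation.ReflTransGen R ⟨a, ha⟩ q →
      ∃ (N : ℕ) (x v : Fin N → E), (∀ j, x j ∈ K) ∧ (∀ j, ‖v j‖ < ε) ∧
        ∀ F : E → ℂ, ∑ j, (F (x j + v j) - F (x j)) = F q - F a from h _ hab
  intro q hq
  induction hq with
  | refl => exact ⟨0, Fin.elim0, Fin.elim0, fun j => j.elim0, fun j => j.elim0, by simp⟩
  | @tail p q _ hpq ih =>
    obtain ⟨N, x, v, hx, hv, hF⟩ := ih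
    refine ⟨N + 1, Fin.snoc x (p : E), Fin.snoc v ((q : E) - p), ?_, ?_, fun F => ?_⟩
    · exact Fin.lastCases (by simp) (by simpa using hx)
    · refine Fin.lastCases ?_ (by simpa using hv)
      have : dist (p : E) q < ε := hpq
      simpa [dist_eq_norm', Fin.snoc_last] using this
    · rw [Fin.sum_univ_castSucc]
      simp only [Fin.snoc_castSucc, Fin.snoc_last, hF]
      simp

variable {d : Type*}

/-- The covering map `ℝᵈ → ℝᵈ / ℤᵈ`. -/
def torusMk (x : d → ℝ) : UnitAddTorus d := fun i => (x i : UnitAddCircle)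

theorem continuous_torusMk : Continuous (torusMk (d := d)) := by
  unfold torusMk
  fun_prop

variable [Fintype d]

theorem dist_torusMk_le (x y : d → ℝ) : dist (torusMk x) (torusMk y) ≤ dist x y := by
  refine (dist_pi_le_iff dist_nonneg).2 fun i => le_trans ?_ (dist_le_pi_dist x y i)
  rw [dist_eq_norm, dist_eq_norm]
  exact QuotientAddGroup.norm_mk_le_norm (S := AddSubgroup.zmultiples (1 : ℝ)) (m := x i - y i)

theorem mFourier_torusMk (k : d → ℤ) (x : d → ℝ) :
    mFourier k (torusMk x) = Complex.exp (2 * Real.pi * Complex.I * ∑ i, (k i : ℂ) * (x i : ℂ)) := by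
  simp only [mFourier, torusMk, ContinuousMap.coe_mk, fourier_coe_apply, Finset.mul_sum,
    Complex.exp_sum]
  refine Finset.prod_congr rfl fun i _ => ?_
  congr 1
  push_cast
  ring

theorem mFourier_torusMk_sum {ι : Type*} (s : Finset ι) (k : d → ℤ) (f : ι → d → ℝ) :
    mFourier k (torusMk (∑ i ∈ s, f i)) = ∏ i ∈ s, mFourier k (torusMk (f i)) := by
  simp only [mFourier_torusMk, ← Complex.exp_sum, ← Finset.mul_sum]
  congr 2
  rw [Finset.sum_comm]
  simp [Finset.mul_sum]

theorem integral_mFourier_of_ne_zero {k : d → ℤ} (hk : k ≠ 0) :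
    ∫ z : UnitAddTorus d, mFourier k z = 0 := by
  obtain ⟨i, hi⟩ := Function.ne_iff.1 hk
  simp only [mFourier, ContinuousMap.coe_mk]
  rw [integral_fintype_prod_volume_eq_prod (fun i (z : UnitAddCircle) => fourier (k i) z)]
  refine Finset.prod_eq_zero (Finset.mem_univ i) ?_
  exact integral_eq_zero_of_add_right_eq_neg (fourier_add_half_inv_index hi one_pos)

/-- Integral of a character along the segment from `x` to `x + v`. -/
theorem segment_integral_mFourier (k : d → ℤ) (x v : d → ℝ) :
    (2 * Real.pi * Complex.I * ∑ i, (k i : ℂ) * (v i : ℂ)) *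
      (∫ s in Ioc (0 : ℝ) 1, mFourier k (torusMk (x + s • v))) =
    mFourier k (torusMk (x + v)) - mFourier k (torusMk x) := by
  have hderiv : ∀ s ∈ uIcc (0 : ℝ) 1, HasDerivAt (fun s : ℝ => mFourier k (torusMk (x + s • v)))
      ((2 * Real.pi * Complex.I * ∑ i, (k i : ℂ) * (v i : ℂ)) *
        mFourier k (torusMk (x + s • v))) s := by
    intro s _
    simp only [mFourier_torusMk]
    have h1 : HasDerivAt (fun s : ℝ => 2 * Real.pi * Complex.I *
        ∑ i, (k i : ℂ) * (((x + s • v) i : ℝ) : ℂ))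
        (2 * Real.pi * Complex.I * ∑ i, (k i : ℂ) * (v i : ℂ)) s := by
      refine HasDerivAt.const_mul _ (HasDerivAt.fun_sum fun i _ => HasDerivAt.const_mul _ ?_)
      have h2 : HasDerivAt (fun s : ℝ => x i + s * v i) (v i) s := by
        simpa using ((hasDerivAt_id s).mul_const (v i)).const_add (x i)
      simpa using h2.ofReal_comp
    have := h1.cexp
    rwa [mul_comm (Complex.exp _)] at this
  have hcont : Continuous fun s : ℝ => mFourier k (torusMk (x + s • v)) :=
    (mFourier k).continuous.comp (continuous_torusMk.comp (by fun_prop))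
  have := intervalIntegral.integral_eq_sub_of_hasDerivAt hderiv
    ((continuous_const.mul hcont).intervalIntegrable _ _)
  rw [intervalIntegral.integral_const_mul, intervalIntegral.integral_of_le zero_le_one] at this
  simpa using this

/-- Integration along a continuous map into a compact space, as a continuous linear functional on
continuous functions. -/
noncomputable def ContinuousMap.integralCompCLM {X Y : Type*} [TopologicalSpace X]
    [MeasurableSpace X] [OpensMeasurableSpace X] [SecondCountableTopology X]
    [TopologicalSpace Y] [CompactSpace Y]
    (μ : Measure X) [IsProbabilityMeasure μ] (g : C(X, Y)) : C(Y, ℂ) →L[ℂ] ℂ :=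
  have hint : ∀ φ : C(Y, ℂ), Integrable (fun s => φ (g s)) μ := fun φ =>
    Integrable.of_bound (C := ‖φ‖)
      (φ.continuous.comp g.continuous).aestronglyMeasurable
      (Filter.Eventually.of_forall fun _ => φ.norm_coe_le_norm _)
  LinearMap.mkContinuous
    { toFun := fun φ => ∫ s, φ (g s) ∂μ
      map_add' := fun φ ψ => integral_add (hint φ) (hint ψ)
      map_smul' := fun c φ => integral_const_mul c _ } 1 fun φ => by
    simpa using norm_integral_le_of_norm_le_const (μ := μ)
      (Filter.Eventually.of_forall fun s => φ.norm_coe_le_norm (g s))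

theorem ContinuousMap.integralCompCLM_apply {X Y : Type*} [TopologicalSpace X]
    [MeasurableSpace X] [OpensMeasurableSpace X] [SecondCountableTopology X]
    [TopologicalSpace Y] [CompactSpace Y]
    (μ : Measure X) [IsProbabilityMeasure μ] (g : C(X, Y)) (φ : C(Y, ℂ)) :
    g.integralCompCLM μ φ = ∫ s, φ (g s) ∂μ := rfl

instance isProbabilityMeasure_restrict_Ioc_zero_one :
    IsProbabilityMeasure (volume.restrict (Ioc (0 : ℝ) 1)) := ⟨by simp⟩

section Polygons

variable [DecidableEq d] {N : d → ℕ} (x v : ∀ i, Fin (N i) → d → ℝ)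

/-- The cell of a sum of polygonal paths indexed by the choice `J` of one segment of each path. -/
def polygonCell (J : ∀ i, Fin (N i)) : C(d → ℝ, UnitAddTorus d) where
  toFun s := torusMk (∑ i, (x i (J i) + s i • v i (J i)))
  continuous_toFun := continuous_torusMk.comp (by fun_prop)

/-- The signed integral over a sum of polygonal paths of a function on the torus. -/
noncomputable def polygonFunctional : C(UnitAddTorus d, ℂ) →L[ℂ] ℂ :=
  ∑ J : ∀ i, Fin (N i), (Matrix.of fun i j => (v i (J i) j : ℂ)).det •
    (polygonCell x v J).integralCompCLM (Measure.pi fun _ => volume.restrict (Ioc (0 : ℝ) 1))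

/-- The signed integral of a character is a determinant. -/
theorem polygonFunctional_mFourier (k : d → ℤ) :
    polygonFunctional x v (mFourier k) = (Matrix.of fun i j => ∑ m : Fin (N i),
      (∫ s in Ioc (0 : ℝ) 1, mFourier k (torusMk (x i m + s • v i m))) * (v i m j : ℂ)).det := by
  have h := (Matrix.detRowAlternating (R := ℂ) (n := d)).toMultilinearMap.map_sum
    (α := fun i => Fin (N i)) (g := fun i m =>
      (∫ s in Ioc (0 : ℝ) 1, mFourier k (torusMk (x i m + s • v i m))) •
        fun j => (v i m j : ℂ))
  have e : (Matrix.of fun i j => ∑ m : Fin (N i),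
      (∫ s in Ioc (0 : ℝ) 1, mFourier k (torusMk (x i m + s • v i m))) * (v i m j : ℂ)) =
      fun i => ∑ m : Fin (N i), (∫ s in Ioc (0 : ℝ) 1, mFourier k (torusMk (x i m + s • v i m))) •
        fun j => (v i m j : ℂ) := by
    ext i j
    simp [Finset.sum_apply]
  rw [e]
  refine Eq.trans ?_ h.symm
  simp only [polygonFunctional, _root_.sum_apply, _root_.smul_apply,
    ContinuousMap.integralCompCLM_apply, polygonCell, ContinuousMap.coe_mk, mFourier_torusMk_sum]
  refine Finset.sum_congr rfl fun J _ => ?_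
  rw [integral_fintype_prod_eq_prod
    (fun i (s : ℝ) => mFourier k (torusMk (x i (J i) + s • v i (J i)))),
    MultilinearMap.map_smul_univ, smul_eq_mul, smul_eq_mul, mul_comm]
  rfl

theorem polygonFunctional_eq_integral
    (hxv : ∀ i, ∀ F : (d → ℝ) → ℂ, ∑ m, (F (x i m + v i m) - F (x i m)) =
      F (Pi.single i 1) - F 0) (φ : C(UnitAddTorus d, ℂ)) :
    polygonFunctional x v φ = ∫ z, φ z := by
  have : IsProbabilityMeasure (volume : Measure UnitAddCircle) := ⟨by simp⟩
  have hdense : Dense (Submodule.span ℂ (range (mFourier (d := d))) : Set C(UnitAddTorus d, ℂ)) :=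
    (Submodule.dense_iff_topologicalClosure_eq_top).2 span_mFourier_closure_eq_top
  suffices h : polygonFunctional x v =
      (ContinuousMap.id (UnitAddTorus d)).integralCompCLM volume by
    rw [h]; rfl
  refine ContinuousLinearMap.ext_on hdense ?_
  rintro _ ⟨k, rfl⟩
  rw [polygonFunctional_mFourier, ContinuousMap.integralCompCLM_apply]
  by_cases hk : k = 0
  · subst hk
    have e : (Matrix.of fun i j => ∑ m : Fin (N i),
      (∫ s in Ioc (0 : ℝ) 1, mFourier (0 : d → ℤ) (torusMk (x i m + s • v i m))) *
        (v i m j : ℂ)) = 1 := by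
      ext i j
      have := hxv i fun y => (y j : ℂ)
      simp only [Pi.add_apply, Complex.ofReal_add, add_sub_cancel_left] at this
      simp [mFourier_zero, this, Matrix.one_apply, Pi.single_apply, eq_comm, apply_ite]
    rw [e]
    simp [mFourier_zero]
  · simp only [ContinuousMap.id_apply]
    rw [integral_mFourier_of_ne_zero hk, ← Matrix.exists_mulVec_eq_zero_iff]
    refine ⟨fun j => (k j : ℂ), fun h => hk (funext fun j => by simpa using congrFun h j), ?_⟩
    ext i
    have h1 := hxv i fun y => mFourier k (torusMk y)
    simp only [← segment_integral_mFourier] at h1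
    have h2 : mFourier k (torusMk (Pi.single i 1)) = mFourier k (torusMk (0 : d → ℝ)) := by
      rw [mFourier_torusMk, mFourier_torusMk]
      simp only [Pi.zero_apply, Complex.ofReal_zero, mul_zero, Finset.sum_const_zero,
        Complex.exp_zero, Pi.single_apply, apply_ite Complex.ofReal, Complex.ofReal_one,
        mul_ite, mul_one, Finset.sum_ite_eq', Finset.mem_univ, if_true]
      rw [mul_comm, Complex.exp_int_mul_two_pi_mul_I]
    have hpi : (2 * Real.pi * Complex.I : ℂ) ≠ 0 := Complex.two_pi_I_ne_zero
    rw [h2, sub_self] at h1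
    simp only [mul_assoc (2 * Real.pi * Complex.I : ℂ), ← Finset.mul_sum] at h1
    have h3 := (mul_eq_zero.1 h1).resolve_left hpi
    rw [Pi.zero_apply, ← h3]
    simp only [Matrix.mulVec, dotProduct, Matrix.of_apply, Finset.sum_mul]
    rw [Finset.sum_comm]
    refine Finset.sum_congr rfl fun m _ => Finset.sum_congr rfl fun j _ => ?_
    ring

end Polygons

/-- A sum of continua joining `0` to the standard basis vectors meets every coset of `ℤᵈ`. -/
theorem exists_torusMk_sum_eq_of_continua [DecidableEq d] (K : d → Set (d → ℝ))
    (hcomp : ∀ i, IsCompact (K i)) (hconn : ∀ i, IsPreconnected (K i)) (h0 : ∀ i, 0 ∈ K i)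
    (h1 : ∀ i, Pi.single i 1 ∈ K i) (y : d → ℝ) :
    ∃ f : d → d → ℝ, (∀ i, f i ∈ K i) ∧ torusMk (∑ i, f i) = torusMk y := by
  let T : Set (UnitAddTorus d) := (fun f : d → d → ℝ => torusMk (∑ i, f i)) '' univ.pi K
  have hT : IsCompact T :=
    (isCompact_univ_pi hcomp).image (continuous_torusMk.comp (by fun_prop))
  have hTne : T.Nonempty := ⟨_, mem_image_of_mem _ (fun i _ => h0 i : (0 : d → d → ℝ) ∈ univ.pi K)⟩
  by_contra! hy
  have hyT : torusMk y ∉ T := by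
    rintro ⟨f, hf, hfy⟩
    exact hy f (fun i => hf i (mem_univ i)) hfy
  have hpos : 0 < Metric.infDist (torusMk y) T :=
    (hT.isClosed.notMem_iff_infDist_pos hTne).1 hyT
  obtain ⟨r, hr, hry⟩ := exists_between hpos
  have hε : 0 < r / (Fintype.card d + 1) := by positivity
  choose N x v hx hv hxv using fun i => (hconn i).exists_telescoping_steps (h0 i) (h1 i) hε
  let ψ : C(UnitAddTorus d, ℝ) :=
    ⟨fun z => max 0 (Metric.infDist z T - r), by fun_prop⟩
  let φ : C(UnitAddTorus d, ℂ) := ⟨fun z => (ψ z : ℂ), by fun_prop⟩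
  have hφ := polygonFunctional_eq_integral x v hxv φ
  have hψpos : 0 < ∫ z, ψ z := by
    refine ψ.continuous.integral_pos_of_hasCompactSupport_nonneg_nonzero
      (HasCompactSupport.of_compactSpace _) (fun z => le_max_left _ _) (x := torusMk y) ?_
    exact (lt_max_of_lt_right (sub_pos.2 hry)).ne'
  have hright : ∫ z, φ z = ((∫ z, ψ z : ℝ) : ℂ) := integral_ofReal
  have hleft : polygonFunctional x v φ = 0 := by
    simp only [polygonFunctional, _root_.sum_apply, _root_.smul_apply,
      ContinuousMap.integralCompCLM_apply]
    refine Finset.sum_eq_zero fun J _ => ?_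
    rw [← Measure.restrict_pi_pi, integral_eq_zero_of_ae, smul_zero]
    refine (ae_restrict_iff' (MeasurableSet.univ_pi fun _ => measurableSet_Ioc)).2
      (Filter.Eventually.of_forall fun s hs => ?_)
    have hmem : torusMk (∑ i, x i (J i)) ∈ T :=
      mem_image_of_mem _ (fun i _ => hx i (J i) : (fun i => x i (J i)) ∈ univ.pi K)
    have hd : Metric.infDist (polygonCell x v J s) T ≤ r := by
      refine (Metric.infDist_le_dist_of_mem hmem).trans ((dist_torusMk_le _ _).trans ?_)
      rw [dist_eq_norm, ← Finset.sum_sub_distrib]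
      simp only [add_sub_cancel_left]
      calc ‖∑ i, s i • v i (J i)‖ ≤ ∑ _i : d, r / (Fintype.card d + 1) := by
            refine norm_sum_le_of_le _ fun i _ => ?_
            rw [norm_smul, Real.norm_of_nonneg (hs i (mem_univ i)).1.le]
            exact (mul_le_of_le_one_left (norm_nonneg _) (hs i (mem_univ i)).2).trans (hv i _).le
        _ = Fintype.card d * (r / (Fintype.card d + 1)) := by simp
        _ ≤ r := by
            rw [mul_div_assoc', div_le_iff₀ (by positivity)]
            nlinarith
    simp only [φ, ψ, ContinuousMap.coe_mk, Pi.zero_apply, Complex.ofReal_eq_zero]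
    exact max_eq_left (sub_nonpos.2 hd)
  rw [hleft, hright] at hφ
  exact hψpos.ne (by exact_mod_cast hφ)

/-- A set meeting every coset of a lattice has at least the volume of a fundamental
parallelotope. -/
theorem ZSpan.measure_fundamentalDomain_le_of_forall_exists_vadd_mem {ι E : Type*} [Finite ι]
    [NormedAddCommGroup E] [NormedSpace ℝ E] [MeasurableSpace E] [BorelSpace E]
    (b : Module.Basis ι ℝ E) (μ : Measure E) [μ.IsAddHaarMeasure] (S : Set E)
    (h : ∀ y, ∃ g : Submodule.span ℤ (range b), g +ᵥ y ∈ S) :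
    μ (ZSpan.fundamentalDomain b) ≤ μ S := by
  have : FiniteDimensional ℝ E := b.finiteDimensional_of_finite
  have : VAddInvariantMeasure (Submodule.span ℤ (range b)) E μ :=
    inferInstanceAs <| VAddInvariantMeasure (Submodule.span ℤ (range b)).toAddSubgroup E μ
  rw [(ZSpan.isAddFundamentalDomain b μ).measure_eq_tsum S]
  refine (measure_mono fun y hy => ?_).trans (measure_iUnion_le _)
  obtain ⟨g, hg⟩ := h y
  exact mem_iUnion.2 ⟨-g, ⟨⟨_, hg, by simp⟩, hy⟩⟩

theorem volume_sum_of_continua_ge_det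
    {n : ℕ} (hn : 0 < n) (K : Fin n → Set (Fin n → ℝ))
    (hne : ∀ i, (K i).Nonempty)
    (hcomp : ∀ i, IsCompact (K i))
    (hconn : ∀ i, IsConnected (K i))
    (h0 : ∀ i, (0 : Fin n → ℝ) ∈ K i)
    (e : Fin n → (Fin n → ℝ)) (he : ∀ i, e i ∈ K i)
    (hind : LinearIndependent ℝ e) :
    ENNReal.ofReal |(Matrix.of fun i j => e j i).det| ≤ volume (familySum K) := by
  have : Nonempty (Fin n) := ⟨⟨0, hn⟩⟩
  let b := basisOfLinearIndependentOfCardEqFinrank hind (by simp)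
  have hb : ∀ i, b i = e i := fun i => by simp [b]
  have hvol : volume (ZSpan.fundamentalDomain b) =
      ENNReal.ofReal |(Matrix.of fun i j => e j i).det| := by
    rw [ZSpan.volume_fundamentalDomain, ← Matrix.det_transpose]
    congr 3
    ext i j
    simp [hb]
  rw [← hvol]
  refine ZSpan.measure_fundamentalDomain_le_of_forall_exists_vadd_mem b volume _ fun y => ?_
  have hcont : Continuous b.equivFun := b.equivFun.toLinearMap.continuous_of_finiteDimensional
  obtain ⟨f, hf, hfy⟩ := exists_torusMk_sum_eq_of_continua (fun i => b.equivFun '' K i)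
    (fun i => (hcomp i).image hcont)
    (fun i => (hconn i).isPreconnected.image _ hcont.continuousOn)
    (fun i => ⟨0, h0 i, map_zero _⟩)
    (fun i => ⟨e i, he i, by ext j; rw [← hb]; simp [Pi.single_apply, eq_comm]⟩)
    (b.equivFun y)
  choose g hgK hgf using hf
  have hint : ∀ i, ∃ m : ℤ, (m : ℝ) = b.repr (∑ i, g i - y) i := fun i => by
    have h := congrFun hfy i
    simp only [torusMk, ← hgf, ← map_sum] at h
    obtain ⟨m, hm⟩ := AddSubgroup.mem_zmultiples_iff.1 (QuotientAddGroup.eq.1 h.symm)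
    refine ⟨m, ?_⟩
    simp at hm
    simp [hm, neg_add_eq_sub]
  refine ⟨⟨∑ i, g i - y, (b.mem_span_iff_repr_mem ℤ _).2 fun i => ?_⟩, g, hgK, ?_⟩
  · obtain ⟨m, hm⟩ := hint i
    exact ⟨m, by simpa using hm⟩
  · simp [Submodule.vadd_def]
end

section
/- Let K₁, …, Kₙ be nonempty compact connected metrizable topological spaces and let K = ∏_{i=1}^n Kᵢ be their product. For every i ≤ n let aᵢ⁻ ≠ aᵢ⁺ be two distinct points of Kᵢ, and let Aᵢ⁻ = {x ∈ K : xᵢ = aᵢ⁻} and Aᵢ⁺ = {x ∈ K : xᵢ = aᵢ⁺} be the corresponding opposite faces. Suppose that for each i, Sᵢ ⊆ K is a separator between Aᵢ⁻ and Aᵢ⁺ in K. Then the intersection S₁ ∩ ⋯ ∩ Sₙ is non-empty. -/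
/-- A closed set `S` is a separator between `A` and `B` in `X` if `A` and `B` are
contained in distinct connected components of the complement `X \ S`. -/
def IsSeparatorBetween {X : Type*} [TopologicalSpace X] (S A B : Set X) : Prop :=
  IsClosed S ∧ ∃ a b : X, a ∈ Sᶜ ∧ b ∈ Sᶜ ∧
    A ⊆ connectedComponentIn Sᶜ a ∧ B ⊆ connectedComponentIn Sᶜ b ∧
    connectedComponentIn Sᶜ a ≠ connectedComponentIn Sᶜ b

namespace HolsztynskiLifanov

open Set Topology

section Cubical

variable {ι : Type*} [DecidableEq ι]

/-- The forward difference of `f` in the direction `j`. -/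
def cubeDiff (j : ι) (f : (ι → ℕ) → ZMod 2) (x : ι → ℕ) : ZMod 2 :=
  f (x + Pi.single j 1) - f x

/-- The component in the directions `I` of the discrete differential form
`d (b i₁) ∧ ⋯ ∧ d (b iₖ)` with coefficients modulo two. -/
def wedgeDiff (b : ι → (ι → ℕ) → ZMod 2) : List ι → Finset ι → (ι → ℕ) → ZMod 2
  | [], _ => 1
  | i :: L, I => ∑ j ∈ I, cubeDiff j (b i * wedgeDiff b L (I.erase j))

lemma cubeDiff_comm (j k : ι) (f : (ι → ℕ) → ZMod 2) :
    cubeDiff j (cubeDiff k f) = cubeDiff k (cubeDiff j f) := by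
  funext x
  simp only [cubeDiff, add_right_comm x (Pi.single j 1)]
  ring

lemma cubeDiff_sum {α : Type*} (j : ι) (s : Finset α) (f : α → (ι → ℕ) → ZMod 2) :
    cubeDiff j (∑ a ∈ s, f a) = ∑ a ∈ s, cubeDiff j (f a) := by
  funext x
  simp [cubeDiff, Finset.sum_apply]

/-- The form `wedgeDiff` is closed. -/
lemma sum_cubeDiff_wedgeDiff (b : ι → (ι → ℕ) → ZMod 2) (L : List ι) (I : Finset ι) :
    ∑ j ∈ I, cubeDiff j (wedgeDiff b L (I.erase j)) = 0 := by
  cases L with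
  | nil =>
    refine Finset.sum_eq_zero fun j _ => ?_
    funext x
    simp [cubeDiff, wedgeDiff]
  | cons i L =>
    simp only [wedgeDiff, cubeDiff_sum]
    rw [Finset.sum_sigma']
    refine Finset.sum_involution (fun p _ => ⟨p.2, p.1⟩) ?_ ?_ ?_ ?_
    · rintro ⟨j, k⟩ _
      dsimp only
      rw [cubeDiff_comm, Finset.erase_right_comm]
      exact CharTwo.add_self_eq_zero _
    · rintro ⟨j, k⟩ h _ h'
      simp only [Finset.mem_sigma, Finset.mem_erase] at h
      exact h.2.1 (congrArg Sigma.fst h')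
    · rintro ⟨j, k⟩ h
      simp only [Finset.mem_sigma, Finset.mem_erase] at h ⊢
      exact ⟨h.2.2, h.2.1.symm, h.1⟩
    · rintro ⟨j, k⟩ _
      rfl

lemma wedgeDiff_cons_apply (b : ι → (ι → ℕ) → ZMod 2) (i : ι) (L : List ι) (I : Finset ι)
    (x : ι → ℕ) :
    wedgeDiff b (i :: L) I x =
      ∑ j ∈ I, (b i (x + Pi.single j 1) - b i x) *
        wedgeDiff b L (I.erase j) (x + Pi.single j 1) := by
  have h := congrArg (b i x * ·) (congrFun (sum_cubeDiff_wedgeDiff b L I) x)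
  simp only [Finset.sum_apply, Pi.zero_apply, mul_zero, cubeDiff, Finset.mul_sum] at h
  rw [← sub_eq_zero, ← h]
  simp only [wedgeDiff, Finset.sum_apply, cubeDiff, Pi.mul_apply]
  rw [← Finset.sum_sub_distrib]
  refine Finset.sum_congr rfl fun j _ => ?_
  ring

/-- Where `wedgeDiff` does not vanish, every function involved varies on the unit cube. -/
lemma exists_ne_of_wedgeDiff_ne_zero (b : ι → (ι → ℕ) → ZMod 2) (L : List ι) :
    ∀ (I : Finset ι) (x : ι → ℕ), wedgeDiff b L I x ≠ 0 → ∀ i ∈ L, ∃ u v : ι → ℕ,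
      (∀ j, x j ≤ u j ∧ u j ≤ x j + if j ∈ I then 1 else 0) ∧
      (∀ j, x j ≤ v j ∧ v j ≤ x j + if j ∈ I then 1 else 0) ∧ b i u ≠ b i v := by
  induction L with
  | nil => simp
  | cons i L ih =>
    intro I x hx
    rw [wedgeDiff_cons_apply] at hx
    obtain ⟨j, hj, h⟩ := Finset.exists_ne_zero_of_sum_ne_zero hx
    have hcell : ∀ u : ι → ℕ, (∀ k, (x + Pi.single j 1 : ι → ℕ) k ≤ u k ∧
        u k ≤ (x + Pi.single j 1 : ι → ℕ) k + if k ∈ I.erase j then 1 else 0) →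
        ∀ k, x k ≤ u k ∧ u k ≤ x k + if k ∈ I then 1 else 0 := by
      intro u hu k
      have := hu k
      by_cases hk : k = j
      · subst hk
        simp [hj] at this ⊢
        omega
      · simpa [hk] using this
    have hne := left_ne_zero_of_mul h
    intro i' hi'
    rcases List.mem_cons.1 hi' with rfl | hi'
    · refine ⟨x + Pi.single j 1, x, hcell _ fun k => by simp, fun k => by simp,
        sub_ne_zero.1 hne⟩
    · obtain ⟨u, v, hu, hv, huv⟩ := ih _ _ (right_ne_zero_of_mul h) i' hi'
      exact ⟨u, v, hcell u hu, hcell v hv, huv⟩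

/-- The sum of `f` over the points obtained from `x` by letting the coordinates in `L` range over
`{0, …, M - 1}`. -/
def boxSum (M : ℕ) (f : (ι → ℕ) → ZMod 2) : List ι → (ι → ℕ) → ZMod 2
  | [], x => f x
  | i :: L, x => ∑ t ∈ Finset.range M, boxSum M f L (Function.update x i t)

lemma boxSum_sum {α : Type*} (M : ℕ) (s : Finset α) (f : α → (ι → ℕ) → ZMod 2) (L : List ι) :
    ∀ x, boxSum M (∑ a ∈ s, f a) L x = ∑ a ∈ s, boxSum M (f a) L x := by
  induction L with
  | nil => simp [boxSum]
  | cons i L ih =>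
    intro x
    simp only [boxSum, ih]
    exact Finset.sum_comm

lemma boxSum_eq_zero {M : ℕ} {f : (ι → ℕ) → ZMod 2} {j : ι} {L : List ι} (hj : j ∉ L) :
    ∀ {x : ι → ℕ}, (∀ y : ι → ℕ, y j = x j → f y = 0) → boxSum M f L x = 0 := by
  induction L with
  | nil => exact fun h => h _ rfl
  | cons i L ih =>
    intro x h
    rw [List.mem_cons, not_or] at hj
    refine Finset.sum_eq_zero fun t _ => ih hj.2 fun y hy => h y ?_
    rw [hy, Function.update_of_ne hj.1]

lemma boxSum_congr {M : ℕ} {f f' : (ι → ℕ) → ZMod 2} {j : ι} {L : List ι} (hj : j ∉ L)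
    {x : ι → ℕ} (h : ∀ y : ι → ℕ, y j = x j → f y = f' y) :
    boxSum M f L x = boxSum M f' L x := by
  induction L generalizing x with
  | nil => exact h _ rfl
  | cons i L ih =>
    rw [List.mem_cons, not_or] at hj
    refine Finset.sum_congr rfl fun t _ => ih hj.2 fun y hy => h y ?_
    rw [hy, Function.update_of_ne hj.1]

lemma boxSum_cubeDiff_of_notMem (M : ℕ) (f : (ι → ℕ) → ZMod 2) {j : ι} {L : List ι}
    (hj : j ∉ L) : ∀ x, boxSum M (cubeDiff j f) L x = cubeDiff j (boxSum M f L) x := by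
  induction L with
  | nil => exact fun x => rfl
  | cons i L ih =>
    intro x
    rw [List.mem_cons, not_or] at hj
    simp only [boxSum, ih hj.2, cubeDiff]
    rw [← Finset.sum_sub_distrib]
    refine Finset.sum_congr rfl fun t _ => ?_
    congr 2
    funext k
    by_cases hk : k = i
    · subst hk
      simp [Ne.symm hj.1]
    · simp [hk]

lemma boxSum_cons_cubeDiff (M : ℕ) (f : (ι → ℕ) → ZMod 2) {j : ι} {L : List ι}
    (hj : j ∉ L) (x : ι → ℕ) :
    boxSum M (cubeDiff j f) (j :: L) x =
      boxSum M f L (Function.update x j M) - boxSum M f L (Function.update x j 0) := by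
  rw [← Finset.sum_range_sub (fun t => boxSum M f L (Function.update x j t)) M]
  refine Finset.sum_congr rfl fun t _ => ?_
  rw [boxSum_cubeDiff_of_notMem M f hj, cubeDiff]
  congr 2
  funext k
  by_cases hk : k = j
  · subst hk
    simp
  · simp [hk]

lemma boxSum_cubeDiff_eq_zero {M : ℕ} {f : (ι → ℕ) → ZMod 2} {j : ι} {L : List ι}
    (hL : L.Nodup) (hj : j ∈ L) (h0 : ∀ y : ι → ℕ, y j = 0 → f y = 0)
    (hM : ∀ y : ι → ℕ, y j = M → f y = 0) : ∀ x, boxSum M (cubeDiff j f) L x = 0 := by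
  induction L with
  | nil => simp at hj
  | cons i L ih =>
    intro x
    rw [List.nodup_cons] at hL
    by_cases hij : j = i
    · subst hij
      rw [boxSum_cons_cubeDiff M f hL.1, boxSum_eq_zero hL.1, boxSum_eq_zero hL.1, sub_zero]
      · intro y hy
        exact h0 y (by simpa using hy)
      · intro y hy
        exact hM y (by simpa using hy)
    · exact Finset.sum_eq_zero fun t _ => ih hL.2 ((List.mem_cons.1 hj).resolve_left hij) _

/-- The integral of `wedgeDiff` over a box, when each function `b i` is `1` on the lower face and
`0` on the upper face in the direction `i`. -/
lemma boxSum_wedgeDiff {M : ℕ} {b : ι → (ι → ℕ) → ZMod 2}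
    (h0 : ∀ i (x : ι → ℕ), x i = 0 → b i x = 1) (hM : ∀ i (x : ι → ℕ), x i = M → b i x = 0)
    {L : List ι} (hL : L.Nodup) : ∀ x, boxSum M (wedgeDiff b L L.toFinset) L x = 1 := by
  induction L with
  | nil => exact fun x => rfl
  | cons i L ih =>
    intro x
    have hnd := hL
    rw [List.nodup_cons] at hL
    rw [wedgeDiff, boxSum_sum, Finset.sum_eq_single_of_mem i (by simp)]
    · rw [boxSum_cons_cubeDiff M _ hL.1, boxSum_eq_zero hL.1, zero_sub, ZMod.neg_eq_self_mod_two]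
      · have he : (i :: L).toFinset.erase i = L.toFinset := by
          simp [hL.1]
        rw [he, ← ih hL.2 (Function.update x i 0)]
        refine boxSum_congr hL.1 fun y hy => ?_
        rw [Pi.mul_apply, h0 i y (by simpa using hy), one_mul]
      · intro y hy
        rw [Pi.mul_apply, hM i y (by simpa using hy), zero_mul]
    · intro j hj hji
      have hjL : j ∈ L := by simpa [hji] using hj
      have key : ∀ y : ι → ℕ, (∀ u : ι → ℕ, u j = y j → b j u = b j y) →
          (b i * wedgeDiff b L ((i :: L).toFinset.erase j)) y = 0 := by
        intro y hy
        by_contra hne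
        obtain ⟨u, v, hu, hv, huv⟩ := exists_ne_of_wedgeDiff_ne_zero b L _ y
          (right_ne_zero_of_mul hne) j hjL
        have hu' := hu j
        have hv' := hv j
        simp only [Finset.notMem_erase, if_false] at hu' hv'
        exact huv ((hy u (by omega)).trans (hy v (by omega)).symm)
      refine boxSum_cubeDiff_eq_zero hnd (List.mem_toFinset.1 hj) (fun y hy => key y fun u hu => ?_)
        (fun y hy => key y fun u hu => ?_) x
      · rw [h0 j u (hu.trans hy), h0 j y hy]
      · rw [hM j u (hu.trans hy), hM j y hy]

/-- A discrete Poincaré–Miranda theorem. -/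
lemma exists_cube_forall_ne [Fintype ι] {M : ℕ} {b : ι → (ι → ℕ) → ZMod 2}
    (h0 : ∀ i (x : ι → ℕ), x i = 0 → b i x = 1) (hM : ∀ i (x : ι → ℕ), x i = M → b i x = 0) :
    ∃ x : ι → ℕ, ∀ i, ∃ u v : ι → ℕ, (∀ j, x j ≤ u j ∧ u j ≤ x j + 1) ∧
      (∀ j, x j ≤ v j ∧ v j ≤ x j + 1) ∧ b i u ≠ b i v := by
  set L := (Finset.univ : Finset ι).toList with hLdef
  have hsum := boxSum_wedgeDiff h0 hM (Finset.nodup_toList (Finset.univ : Finset ι)) 0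
  have hex : ∃ x, wedgeDiff b L L.toFinset x ≠ 0 := by
    by_contra! hall
    have hz : wedgeDiff b L L.toFinset = ∑ a ∈ (∅ : Finset ι), 0 := by
      funext x
      simp [hall x]
    rw [← hLdef, hz, boxSum_sum] at hsum
    simp at hsum
  obtain ⟨x, hx⟩ := hex
  refine ⟨x, fun i => ?_⟩
  simpa [hLdef] using exists_ne_of_wedgeDiff_ne_zero b L _ x hx i (by simp [hLdef])

end Cubical

/-- Any two points of a connected metric space are joined by a chain of small steps. -/
lemma exists_chain {X : Type*} [PseudoMetricSpace X] [PreconnectedSpace X] {ε : ℝ} (hε : 0 < ε)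
    (x y : X) : ∃ (m : ℕ) (c : ℕ → X), c 0 = x ∧ (∀ k, m ≤ k → c k = y) ∧
      ∀ k, dist (c k) (c (k + 1)) < ε := by
  have hstep : ∀ {x y : X}, dist x y < ε → ∃ (m : ℕ) (c : ℕ → X), c 0 = x ∧
      (∀ k, m ≤ k → c k = y) ∧ ∀ k, dist (c k) (c (k + 1)) < ε := by
    intro x y h
    refine ⟨1, fun k => if k = 0 then x else y, by simp, fun k hk => ?_, fun k => ?_⟩
    · simp [Nat.one_le_iff_ne_zero.1 hk]
    · by_cases hk : k = 0 <;> simp [hk, h, hε]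
  refine PreconnectedSpace.induction₂' (fun x y : X => ∃ (m : ℕ) (c : ℕ → X), c 0 = x ∧
      (∀ k, m ≤ k → c k = y) ∧ ∀ k, dist (c k) (c (k + 1)) < ε) ?_ ?_ x y
  · intro x
    filter_upwards [Metric.ball_mem_nhds x hε] with y hy
    exact ⟨hstep (by simpa [dist_comm] using hy), hstep (by simpa using hy)⟩
  · refine ⟨?_⟩
    rintro x y z ⟨m, c, hc0, hcm, hc⟩ ⟨m', c', hc0', hcm', hc'⟩
    refine ⟨m + m', fun k => if k < m then c k else c' (k - m), ?_, fun k hk => ?_, fun k => ?_⟩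
    · rcases Nat.eq_zero_or_pos m with rfl | hm
      · simp [hc0', ← hc0, hcm 0 le_rfl]
      · simp [hm, hc0]
    · simp only [show ¬ k < m by omega, if_false]
      exact hcm' _ (by omega)
    · dsimp only
      rcases lt_trichotomy (k + 1) m with h | h | h
      · simp only [h, show k < m by omega, if_true]
        exact hc k
      · have := hc k
        rw [hcm (k + 1) h.ge, ← hc0'] at this
        simpa [show k < m by omega, h] using this
      · simp only [show ¬ k < m by omega, show ¬ k + 1 < m by omega, if_false,
          show k + 1 - m = k - m + 1 by omega]
        exact hc' _

/-- A version of the Poincaré–Miranda theorem for frontiers in a product of continua. -/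
lemma nonempty_iInter_frontier {ι : Type*} [Fintype ι] {K : ι → Type*}
    [∀ i, PseudoMetricSpace (K i)] [∀ i, CompactSpace (K i)] [∀ i, PreconnectedSpace (K i)]
    (a a' : ∀ i, K i) (W : ι → Set (∀ i, K i)) (hW : ∀ i x, x i = a i → x ∈ W i)
    (hW' : ∀ i x, x i = a' i → x ∉ W i) : (⋂ i, frontier (W i)).Nonempty := by
  classical
  by_contra hempty
  rw [not_nonempty_iff_eq_empty] at hempty
  have hcover : (univ : Set (∀ i, K i)) ⊆
      ⋃ i, (frontier (W i))ᶜ := by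
    rw [← compl_iInter, hempty, compl_empty]
  have hcover' : (univ : Set (∀ i, K i)) ⊆
      ⋃ p : ι × Bool, if p.2 then interior (W p.1) else interior (W p.1)ᶜ := by
    intro x hx
    obtain ⟨i, hi⟩ := mem_iUnion.1 (hcover hx)
    rw [mem_iUnion]
    rw [frontier, mem_compl_iff, mem_sdiff, not_and_not_right] at hi
    by_cases h : x ∈ closure (W i)
    · exact ⟨(i, true), by simpa using hi h⟩
    · exact ⟨(i, false), by simpa [interior_compl] using h⟩
  obtain ⟨ε, hε, hball⟩ := lebesgue_number_lemma_of_metric isCompact_univ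
    (fun p : ι × Bool => by split_ifs <;> exact isOpen_interior) hcover'
  choose m c hc0 hcm hc using fun i => exists_chain hε (a i) (a' i)
  have hle : ∀ i, m i ≤ Finset.univ.sup m := fun i => Finset.le_sup (Finset.mem_univ i)
  obtain ⟨x, hx⟩ := exists_cube_forall_ne (ι := ι) (M := Finset.univ.sup m)
    (b := fun i g => if (fun j => c j (g j)) ∈ W i then 1 else 0)
    (fun i g hg => if_pos (hW i _ (by simp [hg, hc0])))
    (fun i g hg => if_neg (hW' i _ (hcm i _ (hg ▸ hle i))))
  obtain ⟨⟨i, s⟩, hs⟩ := hball (fun j => c j (x j)) (mem_univ _)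
  have hnear : ∀ u : ι → ℕ, (∀ j, x j ≤ u j ∧ u j ≤ x j + 1) →
      (fun j => c j (u j)) ∈ Metric.ball (fun j => c j (x j)) ε := by
    intro u hu
    rw [Metric.mem_ball', dist_pi_lt_iff hε]
    intro j
    rcases (show u j = x j ∨ u j = x j + 1 by have := hu j; omega) with h | h
    · simpa [h] using hε
    · simpa [h] using hc j (x j)
  obtain ⟨u, v, hu, hv, huv⟩ := hx i
  have hu' := hs (hnear u hu)
  have hv' := hs (hnear v hv)
  cases s
  · exact huv (by simp only [if_neg (interior_subset hu' : _ ∈ (W i)ᶜ),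
      if_neg (interior_subset hv' : _ ∈ (W i)ᶜ)])
  · exact huv (by simp only [if_pos (interior_subset hu' : _ ∈ W i),
      if_pos (interior_subset hv' : _ ∈ W i)])

lemma isConnected_face {ι : Type*} {K : ι → Type*} [∀ i, TopologicalSpace (K i)]
    [∀ i, ConnectedSpace (K i)] (i : ι) (a : K i) : IsConnected {x : ∀ j, K j | x i = a} := by
  classical
  have h : {x : ∀ j, K j | x i = a} = range fun x : ∀ j, K j => Function.update x i a := by
    ext x
    refine ⟨fun hx => ⟨x, ?_⟩, ?_⟩
    · rw [← show x i = a from hx]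
      exact Function.update_eq_self i x
    · rintro ⟨y, rfl⟩
      simp
  rw [h]
  exact isConnected_range (continuous_id.update i continuous_const)

/-- Inside a compact subset of the complement of a separator, the two separated sets are
distinguished by a relatively clopen set. -/
lemma exists_frontier_disjoint_of_isSeparatorBetween {X : Type*} [TopologicalSpace X] [T2Space X]
    [CompactSpace X] {S A B v : Set X} (hS : IsSeparatorBetween S A B) (hA : IsConnected A)
    (hB : IsConnected B) (hAc : IsClosed A) (hBc : IsClosed B) (hv : IsOpen v)
    (hvS : closure v ⊆ Sᶜ) :
    ∃ W : Set X, A ⊆ W ∧ Disjoint B W ∧ Disjoint (frontier W) v := by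
  obtain ⟨-, p, q, hp, hq, hAp, hBq, hpq⟩ := hS
  have hAS : A ⊆ Sᶜ := hAp.trans (connectedComponentIn_subset _ _)
  have hBS : B ⊆ Sᶜ := hBq.trans (connectedComponentIn_subset _ _)
  set T : Set X := closure v ∪ A ∪ B with hT
  have hTc : IsClosed T := (isClosed_closure.union hAc).union hBc
  have hTS : T ⊆ Sᶜ := union_subset (union_subset hvS hAS) hBS
  have hAT : A ⊆ T := fun x hx => Or.inl (Or.inr hx)
  have hBT : B ⊆ T := fun x hx => Or.inr hx
  have hvT : v ⊆ T := fun x hx => Or.inl (Or.inl (subset_closure hx))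
  have : CompactSpace T := isCompact_iff_compactSpace.1 hTc.isCompact
  obtain ⟨x, hx⟩ := hA.nonempty
  obtain ⟨y, hy⟩ := hB.nonempty
  have hxy : (⟨y, hBT hy⟩ : T) ∉ connectedComponent (⟨x, hAT hx⟩ : T) := by
    intro hmem
    have hconn : IsPreconnected ((↑) '' connectedComponent (⟨x, hAT hx⟩ : T) : Set X) :=
      isPreconnected_connectedComponent.image _ continuous_subtype_val.continuousOn
    have hsub : ((↑) '' connectedComponent (⟨x, hAT hx⟩ : T) : Set X) ⊆ Sᶜ := by
      rintro _ ⟨z, -, rfl⟩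
      exact hTS z.2
    have hyx := hconn.subset_connectedComponentIn ⟨_, mem_connectedComponent, rfl⟩ hsub
      ⟨_, hmem, rfl⟩
    apply hpq
    rw [connectedComponentIn_eq (hAp hx), connectedComponentIn_eq (hBq hy)]
    exact connectedComponentIn_eq hyx
  rw [connectedComponent_eq_iInter_isClopen, mem_iInter] at hxy
  push Not at hxy
  obtain ⟨⟨Z, hZ, hxZ⟩, hyZ⟩ := hxy
  have hpre : ∀ {C : Set X}, IsConnected C → C ⊆ T → IsPreconnected ((↑) ⁻¹' C : Set T) := by
    intro C hC hCT
    rw [← Topology.IsInducing.subtypeVal.isPreconnected_image,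
      Subtype.image_preimage_coe, inter_eq_right.2 hCT]
    exact hC.isPreconnected
  have hAZ : ((↑) ⁻¹' A : Set T) ⊆ Z := (hpre hA hAT).subset_isClopen hZ ⟨_, hx, hxZ⟩
  have hBZ : ((↑) ⁻¹' B : Set T) ⊆ Zᶜ := (hpre hB hBT).subset_isClopen hZ.compl ⟨_, hy, hyZ⟩
  refine ⟨(↑) '' Z, fun z hz => ⟨⟨z, hAT hz⟩, hAZ hz, rfl⟩, ?_, ?_⟩
  · rw [Set.disjoint_left]
    rintro _ hz ⟨z, hzZ, rfl⟩
    exact hBZ hz hzZ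
  · rw [Set.disjoint_left]
    intro z hz hzv
    have hcl : IsClosed ((↑) '' Z : Set X) := hTc.isClosedEmbedding_subtypeVal.isClosedMap _ hZ.1
    rw [frontier, hcl.closure_eq] at hz
    obtain ⟨⟨z, hzZ, rfl⟩, hzi⟩ := hz
    obtain ⟨O, hO, hOZ⟩ := isOpen_induced_iff.1 hZ.2
    refine hzi (mem_interior.2 ⟨O ∩ v, ?_, hO.inter hv, ?_, hzv⟩)
    · rintro w ⟨hwO, hwv⟩
      exact ⟨⟨w, hvT hwv⟩, hOZ ▸ hwO, rfl⟩
    · rw [← hOZ] at hzZ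
      exact hzZ

end HolsztynskiLifanov

theorem holsztynski_lifanov
    {n : ℕ} (K : Fin n → Type*) [∀ i, TopologicalSpace (K i)]
    [∀ i, Nonempty (K i)] [∀ i, CompactSpace (K i)] [∀ i, ConnectedSpace (K i)]
    [∀ i, TopologicalSpace.MetrizableSpace (K i)]
    (aneg apos : ∀ i, K i) (hdist : ∀ i, aneg i ≠ apos i)
    (S : Fin n → Set (∀ i, K i))
    (hS : ∀ i, IsSeparatorBetween (S i)
      {x : ∀ j, K j | x i = aneg i} {x : ∀ j, K j | x i = apos i}) :
    (⋂ i, S i).Nonempty := by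
  let _ : ∀ i, MetricSpace (K i) := fun i => TopologicalSpace.metrizableSpaceMetric (K i)
  by_contra hempty
  rw [Set.not_nonempty_iff_eq_empty] at hempty
  obtain ⟨v, hv, hvo, hvS⟩ := exists_iUnion_eq_closure_subset (u := fun i => (S i)ᶜ)
    (fun i => (hS i).1.isOpen_compl) (fun x => Set.toFinite _)
    (by rw [← Set.compl_iInter, hempty, Set.compl_empty])
  have hface : ∀ (i : Fin n) (a : K i), IsClosed {x : ∀ j, K j | x i = a} := fun i a =>
    isClosed_eq (continuous_apply i) continuous_const
  choose W hAW hBW hWv using fun i =>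
    HolsztynskiLifanov.exists_frontier_disjoint_of_isSeparatorBetween (hS i)
    (HolsztynskiLifanov.isConnected_face i _)
    (HolsztynskiLifanov.isConnected_face i _) (hface i _) (hface i _) (hvo i) (hvS i)
  obtain ⟨x, hx⟩ := HolsztynskiLifanov.nonempty_iInter_frontier aneg apos W (fun i x hx => hAW i hx)
    (fun i x hx => Set.disjoint_left.1 (hBW i) hx)
  obtain ⟨i, hi⟩ := Set.mem_iUnion.1 (hv ▸ Set.mem_univ x : x ∈ ⋃ i, v i)
  exact Set.disjoint_left.1 (hWv i) (Set.mem_iInter.1 hx i) hi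
end

section
/- Let n ≥ 1 and let K be a nonempty compact connected subset of ℝⁿ. The following conditions are equivalent: (1) the n-fold Minkowski sum K^{+n} has non-empty interior in ℝⁿ; (2) K^{+n} has positive Lebesgue measure in ℝⁿ; (3) the affine span of K equals all of ℝⁿ (i.e., K is not flat); (4) for every non-zero continuous linear functional f : ℝⁿ → ℝ, the image f(K) has non-empty interior in ℝ. -/
open MeasureTheory

/-- The `n`-fold Minkowski sum `T + ⋯ + T` of a set `T`. -/
def nFoldSum {X : Type*} [AddCommMonoid X] (T : Set X) (n : ℕ) : Set X :=
  {x | ∃ f : Fin n → X, (∀ i, f i ∈ T) ∧ ∑ i, f i = x}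

/-- Points of a preconnected set are joined by `ε`-chains, recorded by their families of edges
`(a j, b j)` together with the telescoping property. -/
lemma IsPreconnected.exists_telescoping_edges {E : Type*} [PseudoMetricSpace E] {K : Set E}
    (hK : IsPreconnected K) {ε : ℝ} (hε : 0 < ε) {p q : E} (hp : p ∈ K) (hq : q ∈ K) :
    ∃ (J : Type) (_ : Fintype J) (a b : J → E),
      (∀ j, a j ∈ K ∧ b j ∈ K ∧ dist (a j) (b j) < ε) ∧
      ∀ χ : E → ℂ, ∑ j, (χ (b j) - χ (a j)) = χ q - χ p := by
  refine hK.induction₂ (fun p q ↦ ∃ (J : Type) (_ : Fintype J) (a b : J → E),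
      (∀ j, a j ∈ K ∧ b j ∈ K ∧ dist (a j) (b j) < ε) ∧
      ∀ χ : E → ℂ, ∑ j, (χ (b j) - χ (a j)) = χ q - χ p) ?_ ?_ ?_ hp hq
  · intro x hx
    filter_upwards [self_mem_nhdsWithin, mem_nhdsWithin_of_mem_nhds (Metric.ball_mem_nhds x hε)]
      with y hy hxy
    exact ⟨Unit, inferInstance, fun _ ↦ x, fun _ ↦ y,
      fun _ ↦ ⟨hx, hy, by rwa [dist_comm]⟩, fun χ ↦ by simp⟩
  · rintro x y z - - - ⟨J, _, a, b, hab, h⟩ ⟨J', _, a', b', hab', h'⟩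
    refine ⟨J ⊕ J', inferInstance, Sum.elim a a', Sum.elim b b', ?_, fun χ ↦ ?_⟩
    · rintro (j | j)
      exacts [hab j, hab' j]
    · simp only [Fintype.sum_sum_type, Sum.elim_inl, Sum.elim_inr, h, h']
      ring
  · rintro x y - - ⟨J, _, a, b, hab, h⟩
    refine ⟨J, inferInstance, b, a, fun j ↦ ⟨(hab j).2.1, (hab j).1, ?_⟩, fun χ ↦ ?_⟩
    · rw [dist_comm]
      exact (hab j).2.2
    · rw [← neg_sub, ← h, ← Finset.sum_neg_distrib]
      simp

lemma mul_integral_unitInterval_exp (α β : ℂ) :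
    β * ∫ t : unitInterval, Complex.exp (α + (t : ℝ) * β) =
      Complex.exp (α + β) - Complex.exp α := by
  have h : ∫ t : unitInterval, Complex.exp (α + (t : ℝ) * β) =
      ∫ t in (0 : ℝ)..1, Complex.exp (α + t * β) := by
    rw [intervalIntegral.integral_of_le zero_le_one, ← integral_Icc_eq_integral_Ioc]
    exact unitInterval.measurePreserving_coe.integral_comp unitInterval.measurableEmbedding_coe
      (fun t : ℝ ↦ Complex.exp (α + t * β))
  rw [h, ← intervalIntegral.integral_const_mul,
    intervalIntegral.integral_eq_sub_of_hasDerivAt (f := fun t : ℝ ↦ Complex.exp (α + t * β))]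
  · simp
  · intro t _
    have := (((Complex.ofRealCLM.hasDerivAt (x := t)).mul_const β).const_add α).cexp
    simpa [mul_comm] using this
  · apply Continuous.intervalIntegrable
    fun_prop

namespace UnitAddTorus

/-- The quotient map from `ℝᵈ` to the torus. -/
def mk {d : Type*} (x : d → ℝ) : UnitAddTorus d := fun i ↦ (x i : UnitAddCircle)

lemma continuous_mk {d : Type*} : Continuous (mk : (d → ℝ) → UnitAddTorus d) :=
  continuous_pi fun i ↦ (AddCircle.continuous_mk' 1).comp (continuous_apply i)

variable {d : Type*} [Fintype d]

lemma dist_mk_le (x y : d → ℝ) : dist (mk x) (mk y) ≤ dist x y := by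
  refine (dist_pi_le_iff dist_nonneg).2 fun i ↦ le_trans ?_ (dist_le_pi_dist x y i)
  rw [dist_eq_norm, dist_eq_norm]
  exact QuotientAddGroup.norm_mk_le_norm (S := AddSubgroup.zmultiples (1 : ℝ)) (m := x i - y i)

lemma mFourier_mk (m : d → ℤ) (x : d → ℝ) :
    mFourier m (mk x) = Complex.exp (∑ k, 2 * Real.pi * Complex.I * m k * x k) := by
  simp only [mFourier, ContinuousMap.coe_mk, mk, fourier_coe_apply, Complex.exp_sum]
  simp

lemma integral_mFourier (m : d → ℤ) :
    ∫ y, mFourier m y ∂(Measure.pi fun _ : d ↦ AddCircle.haarAddCircle) =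
      if m = 0 then 1 else 0 := by
  split_ifs with h
  · simp [h, mFourier_zero]
  · obtain ⟨i, hi⟩ := Function.ne_iff.mp h
    simp only [mFourier, ContinuousMap.coe_mk]
    rw [integral_fintype_prod_eq_prod (fun i (y : UnitAddCircle) ↦ fourier (m i) y)]
    refine Finset.prod_eq_zero (Finset.mem_univ i) ?_
    exact integral_eq_zero_of_add_right_eq_neg (fourier_add_half_inv_index hi one_pos)

/-- Integration of continuous functions against a finite measure on the torus. -/
noncomputable def integralCLM (ν : Measure (UnitAddTorus d)) [IsFiniteMeasure ν] :
    C(UnitAddTorus d, ℂ) →L[ℂ] ℂ :=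
  LinearMap.mkContinuous
    { toFun φ := ∫ y, φ y ∂ν
      map_add' φ ψ := integral_add
        (φ.continuous.integrable_of_hasCompactSupport (HasCompactSupport.of_compactSpace _))
        (ψ.continuous.integrable_of_hasCompactSupport (HasCompactSupport.of_compactSpace _))
      map_smul' c φ := integral_const_mul c _ }
    (ν.real Set.univ) fun φ ↦ by
      rw [mul_comm]
      exact norm_integral_le_of_norm_le_const (.of_forall φ.norm_coe_le_norm)

/-- A finite combination of measures on the torus whose nonzero Fourier coefficients vanish is a
multiple of the Haar measure. -/
lemma sum_integral_eq_of_mFourier {R : Type*} [Fintype R]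
    (ν : R → Measure (UnitAddTorus d)) [∀ r, IsFiniteMeasure (ν r)] (c : R → ℂ) (C : ℂ)
    (h : ∀ m, ∑ r, c r * ∫ y, mFourier m y ∂ν r = if m = 0 then C else 0)
    (φ : C(UnitAddTorus d, ℂ)) :
    ∑ r, c r * ∫ y, φ y ∂ν r =
      C * ∫ y, φ y ∂(Measure.pi fun _ : d ↦ AddCircle.haarAddCircle) := by
  have key : ∑ r, c r • integralCLM (ν r) =
      C • integralCLM (Measure.pi fun _ : d ↦ AddCircle.haarAddCircle) := by
    refine ContinuousLinearMap.ext_on (s := Set.range (mFourier (d := d))) ?_ ?_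
    · exact Submodule.dense_iff_topologicalClosure_eq_top.2 span_mFourier_closure_eq_top
    · rintro _ ⟨m, rfl⟩
      simpa [integralCLM, integral_mFourier] using h m
  simpa [integralCLM] using DFunLike.congr_fun key φ

end UnitAddTorus

/-- The Fourier transform at a frequency `m` of the current carried by polygonal loops with edges
`(a i j, b i j)`, in the homology classes of the standard basis. -/
lemma det_sum_integral_exp_smul {d : Type*} [Fintype d] [DecidableEq d] {J : d → Type}
    [∀ i, Fintype (J i)] (a b : ∀ i, J i → d → ℝ) (p : d → ℝ)
    (h : ∀ i, ∀ χ : (d → ℝ) → ℂ,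
      ∑ j, (χ (b i j) - χ (a i j)) = χ (p + Pi.single i 1) - χ p) (m : d → ℤ) :
    Matrix.detRowAlternating (fun i ↦ ∑ j,
      (∫ t : unitInterval, Complex.exp (∑ k, 2 * Real.pi * Complex.I * m k * a i j k +
        (t : ℝ) * ∑ k, 2 * Real.pi * Complex.I * m k * (b i j k - a i j k))) •
      fun k ↦ ((b i j k : ℂ) - a i j k)) = if m = 0 then 1 else 0 := by
  split_ifs with hm
  · subst hm
    have h1 : (1 : Matrix d d ℂ) = fun i ↦ ∑ j, fun k ↦ ((b i j k : ℂ) - a i j k) := by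
      ext i k
      have := h i fun x ↦ (x k : ℂ)
      simp only [Finset.sum_apply, this]
      by_cases hik : i = k
      · subst hik
        simp
      · simp [hik]
    simp only [Pi.zero_apply, Int.cast_zero, mul_zero, zero_mul, Finset.sum_const_zero, add_zero,
      Complex.exp_zero, integral_const, probReal_univ, one_smul]
    rw [← h1]
    exact Matrix.det_one
  · refine Matrix.exists_mulVec_eq_zero_iff.1 ⟨fun k ↦ (m k : ℂ), ?_, ?_⟩
    · contrapose! hm
      ext k
      simpa using congrFun hm k
    · ext i
      have hχ := h i fun x ↦ Complex.exp (∑ k, 2 * Real.pi * Complex.I * m k * x k)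
      have hper : UnitAddTorus.mk (p + Pi.single i 1) = UnitAddTorus.mk p := by
        ext k
        by_cases hik : k = i
        · subst hik
          simp [UnitAddTorus.mk]
        · simp [UnitAddTorus.mk, hik]
      simp only [← UnitAddTorus.mFourier_mk m p, ← UnitAddTorus.mFourier_mk m (p + _), hper,
        sub_self] at hχ
      rw [Pi.zero_apply, ← mul_right_inj' Complex.two_pi_I_ne_zero, mul_zero, ← hχ]
      simp only [Matrix.mulVec, dotProduct, Finset.sum_apply, Pi.smul_apply, smul_eq_mul]
      simp_rw [Finset.sum_mul]
      rw [Finset.sum_comm, Finset.mul_sum]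
      refine Finset.sum_congr rfl fun j _ ↦ ?_
      have := mul_integral_unitInterval_exp (∑ k, 2 * Real.pi * Complex.I * m k * a i j k)
        (∑ k, 2 * Real.pi * Complex.I * m k * (b i j k - a i j k))
      rw [← Finset.sum_add_distrib] at this
      simp_rw [← mul_add, add_sub_cancel] at this
      rw [← this, Finset.mul_sum, Finset.sum_mul]
      exact Finset.sum_congr rfl fun k _ ↦ by ring

/-- If a continuum `K` contains `p` and all `p + eᵢ`, its `d`-fold sum covers the torus. -/
lemma UnitAddTorus.exists_mk_sum_eq {d : Type*} [Fintype d] [DecidableEq d] {K : Set (d → ℝ)}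
    (hK : IsPreconnected K) (hKc : IsCompact K) {p : d → ℝ} (hp : p ∈ K)
    (hpi : ∀ i, p + Pi.single i 1 ∈ K) (y : UnitAddTorus d) :
    ∃ f : d → d → ℝ, (∀ i, f i ∈ K) ∧ mk (∑ i, f i) = y := by
  by_contra! hy
  set S : Set (UnitAddTorus d) := (fun f : d → d → ℝ ↦ mk (∑ i, f i)) '' Set.univ.pi fun _ ↦ K
  have hSc : IsCompact S := (isCompact_univ_pi fun _ ↦ hKc).image
    (continuous_mk.comp (by fun_prop))
  have hSne : S.Nonempty := ⟨_, fun _ ↦ p, fun _ _ ↦ hp, rfl⟩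
  have hyS : y ∉ S := by
    rintro ⟨f, hf, rfl⟩
    exact hy f (fun i ↦ hf i trivial) rfl
  set δ := Metric.infDist y S
  have hδ : 0 < δ := (hSc.isClosed.notMem_iff_infDist_pos hSne).1 hyS
  set ε : ℝ := δ / (2 * (Fintype.card d + 1))
  have hε : 0 < ε := by positivity
  choose J hJ a b hab hχ using fun i ↦ hK.exists_telescoping_edges hε hp (hpi i)
  let g : UnitAddTorus d → ℝ := fun z ↦ max 0 (Metric.infDist z S - δ / 2)
  have hg : Continuous g :=
    continuous_const.max ((Metric.continuous_infDist_pt S).sub continuous_const)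
  let F : (∀ i, J i) → (d → unitInterval) → d → ℝ :=
    fun r t ↦ ∑ i, (a i (r i) + (t i : ℝ) • (b i (r i) - a i (r i)))
  have hF : ∀ r, Continuous fun t ↦ mk (F r t) := fun r ↦ continuous_mk.comp (by fun_prop)
  have hgF : ∀ r t, g (mk (F r t)) = 0 := by
    intro r t
    refine max_eq_left (sub_nonpos.2 ?_)
    have hmem : mk (∑ i, a i (r i)) ∈ S := ⟨_, fun i _ ↦ (hab i (r i)).1, rfl⟩
    calc Metric.infDist (mk (F r t)) S ≤ dist (F r t) (∑ i, a i (r i)) :=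
          (Metric.infDist_le_dist_of_mem hmem).trans (dist_mk_le _ _)
      _ = ‖∑ i, (t i : ℝ) • (b i (r i) - a i (r i))‖ := by
          rw [dist_eq_norm, ← Finset.sum_sub_distrib]
          simp
      _ ≤ ∑ _i : d, ε := by
          refine norm_sum_le_of_le _ fun i _ ↦ ?_
          rw [norm_smul, Real.norm_of_nonneg (t i).2.1, ← dist_eq_norm, dist_comm]
          exact (mul_le_of_le_one_left dist_nonneg (t i).2.2).trans (hab i (r i)).2.2.le
      _ ≤ δ / 2 := by
          simp only [Finset.sum_const, Finset.card_univ, nsmul_eq_mul, ε]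
          rw [mul_div_assoc', div_le_div_iff₀ (by positivity) two_pos]
          nlinarith
  let ν : (∀ i, J i) → Measure (UnitAddTorus d) :=
    fun r ↦ Measure.map (fun t ↦ mk (F r t)) volume
  have hν : ∀ r (φ : C(UnitAddTorus d, ℂ)), ∫ z, φ z ∂ν r = ∫ t, φ (mk (F r t)) := fun r φ ↦
    integral_map (hF r).measurable.aemeasurable φ.continuous.aestronglyMeasurable
  have : ∀ r, IsFiniteMeasure (ν r) := fun r ↦ inferInstanceAs (IsFiniteMeasure (Measure.map _ _))
  have key := sum_integral_eq_of_mFourier ν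
    (fun r ↦ Matrix.detRowAlternating fun i k ↦ ((b i (r i) k : ℂ) - a i (r i) k)) 1 (fun m ↦ by
      rw [← det_sum_integral_exp_smul a b p hχ m, ← AlternatingMap.coe_multilinearMap,
        MultilinearMap.map_sum]
      refine Finset.sum_congr rfl fun r _ ↦ ?_
      rw [MultilinearMap.map_smul_univ, hν, mul_comm, smul_eq_mul,
        ← integral_fintype_prod_volume_eq_prod (fun i (t : unitInterval) ↦
          Complex.exp (∑ k, 2 * Real.pi * Complex.I * m k * a i (r i) k +
            (t : ℝ) * ∑ k, 2 * Real.pi * Complex.I * m k * (b i (r i) k - a i (r i) k)))]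
      congr 2
      ext t
      rw [mFourier_mk, ← Complex.exp_sum]
      congr 1
      simp only [F, Finset.sum_apply, Complex.ofReal_sum, Finset.mul_sum]
      rw [Finset.sum_comm]
      refine Finset.sum_congr rfl fun i _ ↦ ?_
      rw [← Finset.sum_add_distrib]
      refine Finset.sum_congr rfl fun k _ ↦ ?_
      simp
      ring) ⟨fun z ↦ (g z : ℂ), Complex.continuous_ofReal.comp hg⟩
  simp only [hν] at key
  simp only [ContinuousMap.coe_mk, hgF, Complex.ofReal_zero, integral_zero, mul_zero,
    Finset.sum_const_zero, one_mul, integral_complex_ofReal] at key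
  have hpos : 0 < ∫ z, g z ∂(Measure.pi fun _ : d ↦ AddCircle.haarAddCircle) :=
    hg.integral_pos_of_hasCompactSupport_nonneg_nonzero (HasCompactSupport.of_compactSpace _)
      (fun z ↦ le_max_left _ _) (x := y) (by
        have : δ / 2 ≤ g y := (by linarith : δ / 2 ≤ δ - δ / 2).trans (le_max_right _ _)
        linarith)
  exact hpos.ne (mod_cast key)

lemma isCompact_nFoldSum {X : Type*} [AddCommMonoid X] [TopologicalSpace X] [ContinuousAdd X]
    {K : Set X} (hK : IsCompact K) (n : ℕ) : IsCompact (nFoldSum K n) := by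
  have : nFoldSum K n = (fun f : Fin n → X ↦ ∑ i, f i) '' Set.univ.pi fun _ ↦ K := by
    ext x
    simp [nFoldSum]
  rw [this]
  exact (isCompact_univ_pi fun _ ↦ hK).image (by fun_prop)

lemma image_nFoldSum {X Y : Type*} [AddCommMonoid X] [AddCommMonoid Y] (A : X ≃+ Y) (K : Set X)
    (n : ℕ) : nFoldSum (A '' K) n = A '' nFoldSum K n := by
  ext y
  constructor
  · rintro ⟨f, hf, rfl⟩
    choose g hg hgf using hf
    exact ⟨_, ⟨g, hg, rfl⟩, by simp [hgf]⟩
  · rintro ⟨_, ⟨g, hg, rfl⟩, rfl⟩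
    exact ⟨fun i ↦ A (g i), fun i ↦ ⟨_, hg i, rfl⟩, by simp⟩

lemma nonempty_interior_nFoldSum_of_add_single_mem {n : ℕ} {K : Set (Fin n → ℝ)}
    (hK : IsPreconnected K) (hKc : IsCompact K) {p : Fin n → ℝ} (hp : p ∈ K)
    (hpi : ∀ i, p + Pi.single i 1 ∈ K) : (interior (nFoldSum K n)).Nonempty := by
  let T : (Fin n → ℤ) → (Fin n → ℝ) ≃ₜ (Fin n → ℝ) := fun m ↦
    Homeomorph.addRight fun i ↦ (m i : ℝ)
  have hcover : ⋃ m, T m '' nFoldSum K n = Set.univ := by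
    refine Set.eq_univ_of_forall fun x ↦ ?_
    obtain ⟨f, hf, hfx⟩ := UnitAddTorus.exists_mk_sum_eq hK hKc hp hpi (UnitAddTorus.mk x)
    have : ∀ i, ∃ m : ℤ, m = x i - (∑ j, f j) i := fun i ↦ by
      have h : ((x i - (∑ j, f j) i : ℝ) : UnitAddCircle) = 0 := by
        rw [AddCircle.coe_sub, sub_eq_zero]
        exact (congrFun hfx i).symm
      simpa using (AddCircle.coe_eq_zero_iff (1 : ℝ)).1 h
    choose m hm using this
    refine Set.mem_iUnion.2 ⟨m, _, ⟨f, hf, rfl⟩, ?_⟩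
    ext i
    simp [T, hm]
  obtain ⟨m, hm⟩ := nonempty_interior_of_iUnion_of_closed
    (fun m ↦ (T m).isClosedMap _ (isCompact_nFoldSum hKc n).isClosed) hcover
  rw [← (T m).image_interior] at hm
  exact hm.of_image

lemma exists_basis_add_mem_of_affineSpan_eq_top {V : Type*} [AddCommGroup V] [Module ℝ V]
    [FiniteDimensional ℝ V] {K : Set V} (hK : affineSpan ℝ K = ⊤) {p : V} (hp : p ∈ K) :
    ∃ B : Module.Basis (Fin (Module.finrank ℝ V)) ℝ V, ∀ i, p + B i ∈ K := by
  have hspan : ⊤ ≤ Submodule.span ℝ ((· -ᵥ p) '' K) := by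
    rw [← vectorSpan_eq_span_vsub_set_right ℝ hp, ← direction_affineSpan, hK,
      AffineSubspace.direction_top]
  let B := Module.Basis.ofSpan hspan
  refine ⟨B.reindex (Fintype.equivFinOfCardEq (Module.finrank_eq_card_basis B).symm), fun i ↦ ?_⟩
  obtain ⟨x, hx, hxi⟩ := Module.Basis.ofSpan_subset hspan (Set.mem_range_self
    ((Fintype.equivFinOfCardEq (Module.finrank_eq_card_basis B).symm).symm i))
  rw [Module.Basis.reindex_apply]
  change p + Module.Basis.ofSpan hspan _ ∈ K
  rw [← hxi]
  simpa using hx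

lemma nonempty_interior_nFoldSum_of_affineSpan_eq_top {n : ℕ} {K : Set (Fin n → ℝ)}
    (hK : IsConnected K) (hKc : IsCompact K) (hspan : affineSpan ℝ K = ⊤) :
    (interior (nFoldSum K n)).Nonempty := by
  obtain ⟨p, hp⟩ := hK.nonempty
  obtain ⟨B, hB⟩ := exists_basis_add_mem_of_affineSpan_eq_top hspan hp
  let B' := B.reindex (finCongr (Module.finrank_fin_fun ℝ))
  have hB' : ∀ i, p + B' i ∈ K := fun i ↦ by
    rw [Module.Basis.reindex_apply]
    exact hB _
  let A : (Fin n → ℝ) ≃L[ℝ] (Fin n → ℝ) := B'.equivFun.toContinuousLinearEquiv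
  have h := nonempty_interior_nFoldSum_of_add_single_mem
    (hK.isPreconnected.image A A.continuous.continuousOn) (hKc.image A.continuous)
    (Set.mem_image_of_mem A hp) fun i ↦
      ⟨_, hB' i, by
        rw [map_add]
        congr 1
        ext j
        change B'.equivFun (B' i) j = _
        rw [B'.equivFun_self, Pi.single_apply]
        simp only [eq_comm]⟩
  rw [show nFoldSum (A '' K) n = A '' nFoldSum K n from
    image_nFoldSum (A : (Fin n → ℝ) ≃+ (Fin n → ℝ)) K n] at h
  have h' := A.toHomeomorph.image_interior (nFoldSum K n)
  rw [ContinuousLinearEquiv.coe_toHomeomorph] at h'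
  rw [← h'] at h
  exact h.of_image

lemma affineSpan_ne_top_iff_exists_continuousLinearMap {V : Type*} [NormedAddCommGroup V]
    [NormedSpace ℝ V] [FiniteDimensional ℝ V] {K : Set V} (hne : K.Nonempty) :
    affineSpan ℝ K ≠ ⊤ ↔ ∃ f : V →L[ℝ] ℝ, f ≠ 0 ∧ ∃ c, ∀ x ∈ K, f x = c := by
  obtain ⟨p, hp⟩ := hne
  rw [Ne, AffineSubspace.affineSpan_eq_top_iff_vectorSpan_eq_top_of_nonempty ℝ V V ⟨p, hp⟩]
  constructor
  · intro h
    obtain ⟨f, hf, hker⟩ := Submodule.exists_le_ker_of_lt_top _ (lt_top_iff_ne_top.2 h)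
    refine ⟨f.toContinuousLinearMap, by simpa using hf, f p, fun x hx ↦ ?_⟩
    simpa [sub_eq_zero] using hker (vsub_mem_vectorSpan ℝ hx hp)
  · rintro ⟨f, hf, c, hc⟩ htop
    have : vectorSpan ℝ K ≤ LinearMap.ker (f : V →ₗ[ℝ] ℝ) := by
      refine Submodule.span_le.2 ?_
      rintro _ ⟨x, hx, y, hy, rfl⟩
      simp [hc x hx, hc y hy]
    refine hf (ContinuousLinearMap.ext fun x ↦ ?_)
    exact this (htop ▸ Submodule.mem_top)

lemma volume_nFoldSum_eq_zero {n : ℕ} {K : Set (Fin n → ℝ)} (hne : K.Nonempty)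
    (hspan : affineSpan ℝ K ≠ ⊤) : volume (nFoldSum K n) = 0 := by
  obtain ⟨f, hf, c, hc⟩ := (affineSpan_ne_top_iff_exists_continuousLinearMap hne).1 hspan
  obtain ⟨p, hp⟩ := hne
  have hsum : ∀ x ∈ nFoldSum K n, f x = n * c := by
    rintro _ ⟨g, hg, rfl⟩
    simp [hc _ (hg _)]
  have hne' : (nFoldSum K n).Nonempty := ⟨_, fun _ ↦ p, fun _ ↦ hp, rfl⟩
  refine measure_mono_null (subset_affineSpan ℝ _) (Measure.addHaar_affineSubspace volume _ ?_)
  exact (affineSpan_ne_top_iff_exists_continuousLinearMap hne').2 ⟨f, hf, _, hsum⟩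

lemma IsPreconnected.nonempty_interior_of_nontrivial {s : Set ℝ} (hs : IsPreconnected s)
    (h : s.Nontrivial) : (interior s).Nonempty := by
  obtain ⟨a, ha, b, hb, hab⟩ := h.exists_lt
  exact (Set.nonempty_Ioo.2 hab).mono
    (interior_maximal (Set.Ioo_subset_Icc_self.trans (hs.Icc_subset ha hb)) isOpen_Ioo)

theorem continuum_nonflat_tfae
    {n : ℕ} (hn : 0 < n) (K : Set (Fin n → ℝ))
    (hne : K.Nonempty) (hcomp : IsCompact K) (hconn : IsConnected K) :
    List.TFAE
      [(interior (nFoldSum K n)).Nonempty,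
       0 < volume (nFoldSum K n),
       affineSpan ℝ K = ⊤,
       ∀ f : (Fin n → ℝ) →L[ℝ] ℝ, f ≠ 0 → (interior (f '' K)).Nonempty] := by
  tfae_have 1 → 2 := Measure.measure_pos_of_nonempty_interior volume
  tfae_have 2 → 3 := fun h ↦ by
    contrapose! h
    exact (volume_nFoldSum_eq_zero hne h).le
  tfae_have 3 → 1 := nonempty_interior_nFoldSum_of_affineSpan_eq_top hconn hcomp
  tfae_have 3 → 4 := fun h f hf ↦ by
    refine (hconn.isPreconnected.image f f.continuous.continuousOn).nonempty_interior_of_nontrivial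
      (Set.not_subsingleton_iff.1 fun hsub ↦ ?_)
    obtain ⟨p, hp⟩ := hne
    exact (affineSpan_ne_top_iff_exists_continuousLinearMap ⟨p, hp⟩).2 ⟨f, hf, f p, fun x hx ↦
      hsub (Set.mem_image_of_mem f hx) (Set.mem_image_of_mem f hp)⟩ h
  tfae_have 4 → 3 := fun h ↦ by
    by_contra hspan
    obtain ⟨f, hf, c, hc⟩ := (affineSpan_ne_top_iff_exists_continuousLinearMap hne).1 hspan
    have hsub : f '' K ⊆ {c} := by
      rintro _ ⟨x, hx, rfl⟩
      exact hc x hx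
    simpa using (h f hf).mono (interior_mono hsub)
  tfae_finish
end

section
/- Let n ≥ 1 and let K be a nonempty compact connected subset of ℝⁿ whose affine span equals all of ℝⁿ. Then every additive function f : ℝⁿ → ℝ whose image f(K) is bounded above in ℝ is continuous. -/
open MeasureTheory Set Topology

/-- A measure on pairs (position, velocity) representing a one-dimensional current carried by `U`
and running from `a` to `b`: it satisfies the fundamental theorem of calculus. -/
structure IsPathCurrent {E : Type*} [NormedAddCommGroup E] [NormedSpace ℝ E] [MeasurableSpace E]
    (μ : Measure (E × E)) (U : Set E) (a b : E) : Prop where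
  isFiniteMeasure : IsFiniteMeasure μ
  ae_mem : ∀ᵐ p ∂μ, p.1 ∈ U
  integrable : ∀ F : E × E → ℂ, Continuous F → Integrable F μ
  integral_fderiv : ∀ (h : E → ℂ) (h' : E → E →L[ℝ] ℂ), (∀ x, HasFDerivAt h (h' x) x) →
    Continuous h' → ∫ p, h' p.1 p.2 ∂μ = h b - h a

namespace IsPathCurrent

variable {E : Type*} [NormedAddCommGroup E] [NormedSpace ℝ E] [MeasurableSpace E]

theorem add {μ ν : Measure (E × E)} {U : Set E} {a b c : E}
    (hμ : IsPathCurrent μ U a b) (hν : IsPathCurrent ν U b c) :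
    IsPathCurrent (μ + ν) U a c where
  isFiniteMeasure := by
    have := hμ.isFiniteMeasure
    have := hν.isFiniteMeasure
    infer_instance
  ae_mem := by
    rw [ae_add_measure_iff]
    exact ⟨hμ.ae_mem, hν.ae_mem⟩
  integrable F hF := (hμ.integrable F hF).add_measure (hν.integrable F hF)
  integral_fderiv h h' hh hc := by
    have hF : Continuous fun p : E × E => h' p.1 p.2 := by fun_prop
    rw [integral_add_measure (hμ.integrable _ hF) (hν.integrable _ hF),
      hμ.integral_fderiv h h' hh hc, hν.integral_fderiv h h' hh hc]
    ring

variable [BorelSpace E] [SecondCountableTopology E]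

theorem exists_of_segment_subset {U : Set E} {a b : E} (hU : segment ℝ a b ⊆ U) :
    ∃ μ : Measure (E × E), IsPathCurrent μ U a b := by
  set c : ℝ → E × E := fun s => (a + s • (b - a), b - a)
  have hcont : Continuous c := by fun_prop
  have hcm : Measurable c := hcont.measurable
  refine ⟨(volume.restrict (Icc (0 : ℝ) 1)).map c, ?_, ?_, ?_, ?_⟩
  · infer_instance
  · have hcl : (segment ℝ a b) = (fun s : ℝ => a + s • (b - a)) '' Icc 0 1 :=
      segment_eq_image' ℝ a b
    have hmeas : MeasurableSet {p : E × E | p.1 ∈ segment ℝ a b} := by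
      refine (IsCompact.isClosed ?_).measurableSet.preimage measurable_fst
      rw [hcl]
      exact isCompact_Icc.image (by fun_prop)
    have : ∀ᵐ p ∂((volume.restrict (Icc (0 : ℝ) 1)).map c), p.1 ∈ segment ℝ a b := by
      rw [ae_map_iff hcm.aemeasurable hmeas]
      filter_upwards [ae_restrict_mem measurableSet_Icc] with s hs
      rw [hcl]
      exact ⟨s, hs, rfl⟩
    filter_upwards [this] with p hp using hU hp
  · intro F hF
    rw [integrable_map_measure hF.aestronglyMeasurable hcm.aemeasurable]
    exact (hF.comp hcont).continuousOn.integrableOn_compact isCompact_Icc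
  · intro h h' hh hc'
    have hF : Continuous fun p : E × E => h' p.1 p.2 := by fun_prop
    rw [integral_map hcm.aemeasurable hF.aestronglyMeasurable, integral_Icc_eq_integral_Ioc,
      ← intervalIntegral.integral_of_le zero_le_one]
    have key := intervalIntegral.integral_eq_sub_of_hasDerivAt (a := 0) (b := 1)
      (f := fun s : ℝ => h (a + s • (b - a))) (f' := fun s => h' (c s).1 (c s).2) (fun s _ => ?_)
      ((hF.comp hcont).intervalIntegrable _ _)
    · simpa using key
    · have h1 : HasDerivAt (fun s : ℝ => a + s • (b - a)) (b - a) s := by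
        simpa using ((hasDerivAt_id s).smul_const (b - a)).const_add a
      exact (hh _).comp_hasDerivAt s h1

theorem exists_of_isPreconnected {K : Set E} (hK : IsPreconnected K) {ε : ℝ} (hε : 0 < ε)
    {a b : E} (ha : a ∈ K) (hb : b ∈ K) :
    ∃ μ : Measure (E × E), IsPathCurrent μ (Metric.thickening ε K) a b := by
  refine hK.induction₂' (fun a b => ∃ μ : Measure (E × E),
    IsPathCurrent μ (Metric.thickening ε K) a b) (fun x hx => ?_) ?_ ha hb
  · filter_upwards [nhdsWithin_le_nhds (Metric.ball_mem_nhds x hε)] with y hy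
    have hsub : Metric.ball x ε ⊆ Metric.thickening ε K := Metric.ball_subset_thickening hx ε
    have hx' := Metric.mem_ball_self (x := x) hε
    exact ⟨exists_of_segment_subset (((convex_ball x ε).segment_subset hx' hy).trans hsub),
      exists_of_segment_subset (((convex_ball x ε).segment_subset hy hx').trans hsub)⟩
  · rintro x y z - - - ⟨μ, hμ⟩ ⟨ν, hν⟩
    exact ⟨μ + ν, hμ.add hν⟩

end IsPathCurrent

namespace UnitAddTorus

variable {ι : Type*} [Fintype ι]

theorem mFourier_coe (k : ι → ℤ) (x : ι → ℝ) :
    mFourier k (fun j => (x j : UnitAddCircle)) =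
      Complex.exp (2 * Real.pi * Complex.I * ∑ j, (k j : ℂ) * x j) := by
  simp only [mFourier, ContinuousMap.coe_mk, fourier_coe_apply, ← Complex.exp_sum]
  congr 1
  rw [Finset.mul_sum]
  refine Finset.sum_congr rfl fun j _ => ?_
  push_cast
  ring

theorem mFourier_sum {κ : Type*} (s : Finset κ) (k : ι → ℤ) (x : κ → UnitAddTorus ι) :
    mFourier k (∑ i ∈ s, x i) = ∏ i ∈ s, mFourier k (x i) := by
  classical
  induction s using Finset.induction_on with
  | empty => simp [mFourier]
  | insert a s ha ih =>
    rw [Finset.sum_insert ha, Finset.prod_insert ha, ← ih]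
    simp [mFourier, fourier_apply, smul_add, AddCircle.toCircle_add, Finset.prod_mul_distrib]

theorem integral_mFourier_eq_zero {k : ι → ℤ} (hk : k ≠ 0) :
    ∫ x, mFourier k x ∂(Measure.pi fun _ : ι => (AddCircle.haarAddCircle (T := (1 : ℝ)))) = 0 := by
  simp only [mFourier, ContinuousMap.coe_mk]
  rw [integral_fintype_prod_eq_prod (f := fun i (x : UnitAddCircle) => (fourier (k i) x : ℂ))]
  obtain ⟨i, hi⟩ := Function.ne_iff.mp hk
  exact Finset.prod_eq_zero (Finset.mem_univ i)
    (integral_eq_zero_of_add_right_eq_neg (fourier_add_half_inv_index hi one_pos))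

/-- The derivative of the character `mFourier k`, lifted to `ι → ℝ`. -/
noncomputable def mFourierDeriv (k : ι → ℤ) (x : ι → ℝ) : (ι → ℝ) →L[ℝ] ℂ :=
  mFourier k (fun j => (x j : UnitAddCircle)) • ((2 * Real.pi * Complex.I : ℂ) •
    ∑ j, (k j : ℂ) • (Complex.ofRealCLM.comp (ContinuousLinearMap.proj j : (ι → ℝ) →L[ℝ] ℝ)))

theorem mFourierDeriv_apply (k : ι → ℤ) (x v : ι → ℝ) :
    mFourierDeriv k x v = 2 * Real.pi * Complex.I *
      ∑ j, (k j : ℂ) * (v j * mFourier k (fun j => (x j : UnitAddCircle))) := by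
  simp only [mFourierDeriv, smul_apply, sum_apply, ContinuousLinearMap.comp_apply,
    ContinuousLinearMap.proj_apply, Complex.ofRealCLM_apply, smul_eq_mul, ← mul_assoc,
    ← Finset.sum_mul]
  ring

theorem continuous_mFourierDeriv (k : ι → ℤ) : Continuous (mFourierDeriv k) := by
  have : Continuous fun x : ι → ℝ => mFourier k (fun j => (x j : UnitAddCircle)) := by
    simp only [mFourier_coe]
    fun_prop
  exact this.smul continuous_const

theorem hasFDerivAt_mFourier_coe (k : ι → ℤ) (x : ι → ℝ) :
    HasFDerivAt (fun x : ι → ℝ => mFourier k (fun j => (x j : UnitAddCircle)))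
      (mFourierDeriv k x) x := by
  simp only [mFourierDeriv, mFourier_coe]
  set L : (ι → ℝ) →L[ℝ] ℂ := (2 * Real.pi * Complex.I : ℂ) •
    ∑ j, (k j : ℂ) • (Complex.ofRealCLM.comp (ContinuousLinearMap.proj j : (ι → ℝ) →L[ℝ] ℝ))
    with hL
  have hLx : ∀ y, L y = 2 * Real.pi * Complex.I * ∑ j, (k j : ℂ) * y j := by
    intro y; simp [hL]
  simpa only [hLx] using (L.hasFDerivAt (x := x)).cexp

end UnitAddTorus

section Equidistribution

variable {ι : Type*} [Fintype ι] [DecidableEq ι]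
  {μ : ι → Measure ((ι → ℝ) × (ι → ℝ))} {U : Set (ι → ℝ)}

open UnitAddTorus

theorem integrable_det_velocity
    (hμ : ∀ i, IsPathCurrent (μ i) U 0 (Pi.single i 1)) :
    Integrable (fun p : ι → (ι → ℝ) × (ι → ℝ) =>
      (Matrix.of fun j i => ((p i).2 j : ℂ)).det) (Measure.pi μ) := by
  have := fun i => (hμ i).isFiniteMeasure
  simp only [Matrix.det_apply', Matrix.of_apply]
  refine integrable_finsetSum _ fun σ _ => Integrable.const_mul ?_ _
  exact Integrable.fintype_prod_dep (f := fun i (q : (ι → ℝ) × (ι → ℝ)) => (q.2 (σ i) : ℂ))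
    fun i => (hμ i).integrable _ (by fun_prop)

theorem integral_mFourier_mul_det_velocity
    (hμ : ∀ i, IsPathCurrent (μ i) U 0 (Pi.single i 1)) (k : ι → ℤ) :
    ∫ p, mFourier k (∑ i, fun j => ((p i).1 j : UnitAddCircle)) *
        (Matrix.of fun j i => ((p i).2 j : ℂ)).det ∂Measure.pi μ =
      (Matrix.of fun j i => ∫ q : (ι → ℝ) × (ι → ℝ),
        (q.2 j : ℂ) * mFourier k (fun j => (q.1 j : UnitAddCircle)) ∂μ i).det := by
  have := fun i => (hμ i).isFiniteMeasure
  have hint : ∀ j i, Integrable (fun q : (ι → ℝ) × (ι → ℝ) =>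
      (q.2 j : ℂ) * mFourier k (fun j => (q.1 j : UnitAddCircle))) (μ i) := by
    intro j i
    refine (hμ i).integrable _ ?_
    simp only [mFourier_coe]
    fun_prop
  simp only [Matrix.det_apply', Matrix.of_apply, mFourier_sum]
  simp only [Finset.mul_sum, mul_left_comm _ ((Equiv.Perm.sign _ : ℤ) : ℂ),
    ← Finset.prod_mul_distrib, mul_comm (mFourier k _)]
  rw [integral_finsetSum]
  · refine Finset.sum_congr rfl fun σ _ => ?_
    rw [integral_const_mul, integral_fintype_prod_eq_prod (f := fun i (q : (ι → ℝ) × (ι → ℝ)) =>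
      (q.2 (σ i) : ℂ) * mFourier k (fun j => (q.1 j : UnitAddCircle)))]
  · refine fun σ _ => Integrable.const_mul ?_ _
    exact Integrable.fintype_prod_dep (f := fun i (q : (ι → ℝ) × (ι → ℝ)) =>
      (q.2 (σ i) : ℂ) * mFourier k (fun j => (q.1 j : UnitAddCircle))) fun i => hint _ i

theorem det_integral_velocity_mul_mFourier
    (hμ : ∀ i, IsPathCurrent (μ i) U 0 (Pi.single i 1)) (k : ι → ℤ) :
    (Matrix.of fun j i => ∫ q : (ι → ℝ) × (ι → ℝ),
        (q.2 j : ℂ) * mFourier k (fun j => (q.1 j : UnitAddCircle)) ∂μ i).det =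
      if k = 0 then 1 else 0 := by
  split_ifs with hk
  · subst hk
    rw [← Matrix.det_one (n := ι) (R := ℂ)]
    congr 1
    ext j i
    have := (hμ i).integral_fderiv (fun x => (x j : ℂ))
      (fun _ => Complex.ofRealCLM.comp (ContinuousLinearMap.proj j : (ι → ℝ) →L[ℝ] ℝ))
      (fun x => (Complex.ofRealCLM.comp
        (ContinuousLinearMap.proj j : (ι → ℝ) →L[ℝ] ℝ)).hasFDerivAt) continuous_const
    simp only [ContinuousLinearMap.comp_apply, ContinuousLinearMap.proj_apply,
      Complex.ofRealCLM_apply] at this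
    simp [mFourier_zero, this, Matrix.one_apply, Pi.single_apply, apply_ite]
  · rw [← Matrix.exists_vecMul_eq_zero_iff]
    refine ⟨fun j => (k j : ℂ), fun h => hk (funext fun j => by simpa using congrFun h j), ?_⟩
    ext i
    have hint : ∀ j, Integrable (fun q : (ι → ℝ) × (ι → ℝ) =>
        (k j : ℂ) * ((q.2 j : ℂ) * mFourier k (fun j => (q.1 j : UnitAddCircle)))) (μ i) := by
      intro j
      refine (hμ i).integrable _ ?_
      simp only [mFourier_coe]
      fun_prop
    have := (hμ i).integral_fderiv _ _ (hasFDerivAt_mFourier_coe k) (continuous_mFourierDeriv k)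
    simp only [mFourierDeriv_apply] at this
    rw [integral_const_mul, integral_finsetSum _ fun j _ => hint j] at this
    simp only [integral_const_mul] at this
    have hsame : mFourier k (fun j => ((Pi.single i 1 : ι → ℝ) j : UnitAddCircle)) =
        mFourier k (fun j => ((0 : ι → ℝ) j : UnitAddCircle)) := by
      congr 1
      ext j
      obtain rfl | hj := eq_or_ne j i
      · simp
      · simp [hj]
    rw [hsame, sub_self] at this
    simpa [Matrix.vecMul, dotProduct, Complex.two_pi_I_ne_zero] using this

theorem integral_comp_mul_det_velocity
    (hμ : ∀ i, IsPathCurrent (μ i) U 0 (Pi.single i 1)) (φ : C(UnitAddTorus ι, ℂ)) :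
    ∫ p, φ (∑ i, fun j => ((p i).1 j : UnitAddCircle)) *
        (Matrix.of fun j i => ((p i).2 j : ℂ)).det ∂Measure.pi μ =
      ∫ x, φ x ∂(Measure.pi fun _ : ι => (AddCircle.haarAddCircle (T := (1 : ℝ)))) := by
  set m := Measure.pi fun _ : ι => (AddCircle.haarAddCircle (T := (1 : ℝ)))
  set D : (ι → (ι → ℝ) × (ι → ℝ)) → ℂ := fun p => (Matrix.of fun j i => ((p i).2 j : ℂ)).det
  set g : (ι → (ι → ℝ) × (ι → ℝ)) → UnitAddTorus ι :=
    fun p => ∑ i, fun j => ((p i).1 j : UnitAddCircle)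
  have hgc : Continuous g := by
    refine continuous_finsetSum _ fun i _ => continuous_pi fun j => ?_
    exact (AddCircle.continuous_mk' 1).comp (by fun_prop)
  have hDi : Integrable D (Measure.pi μ) := integrable_det_velocity hμ
  have hle : ∀ (φ : C(UnitAddTorus ι, ℂ)) p, ‖φ (g p) * D p‖ ≤ ‖φ‖ * ‖D p‖ := fun φ p => by
    rw [norm_mul]
    exact mul_le_mul_of_nonneg_right (φ.norm_coe_le_norm _) (norm_nonneg _)
  have hφD : ∀ φ : C(UnitAddTorus ι, ℂ), Integrable (fun p => φ (g p) * D p) (Measure.pi μ) :=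
    fun φ => hDi.bdd_mul (c := ‖φ‖) (φ.continuous.comp hgc).aestronglyMeasurable
      (.of_forall fun p => φ.norm_coe_le_norm _)
  have hφm : ∀ φ : C(UnitAddTorus ι, ℂ), Integrable φ m := fun φ =>
    φ.continuous.integrable_of_hasCompactSupport (HasCompactSupport.of_compactSpace _)
  let Λ : C(UnitAddTorus ι, ℂ) →L[ℂ] ℂ := LinearMap.mkContinuous
    { toFun := fun φ => ∫ p, φ (g p) * D p ∂Measure.pi μ
      map_add' := fun φ ψ => by
        simp only [ContinuousMap.add_apply, add_mul]
        exact integral_add (hφD φ) (hφD ψ)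
      map_smul' := fun c φ => by
        simp only [ContinuousMap.smul_apply, smul_eq_mul, mul_assoc, RingHom.id_apply]
        exact integral_const_mul _ _ } (∫ p, ‖D p‖ ∂Measure.pi μ) fun φ => by
      refine (norm_integral_le_of_norm_le (hDi.norm.const_mul ‖φ‖)
        (.of_forall (hle φ))).trans_eq ?_
      rw [integral_const_mul, mul_comm]
  let I : C(UnitAddTorus ι, ℂ) →L[ℂ] ℂ := LinearMap.mkContinuous
    { toFun := fun φ => ∫ x, φ x ∂m
      map_add' := fun φ ψ => integral_add (hφm φ) (hφm ψ)
      map_smul' := fun c φ => integral_const_mul _ _ } 1 fun φ => by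
      refine (norm_integral_le_of_norm_le_const (.of_forall φ.norm_coe_le_norm)).trans_eq ?_
      simp [m]
  have hΛI : Λ = I := by
    refine ContinuousLinearMap.ext_on (s := range (mFourier (d := ι))) ?_ ?_
    · exact Submodule.dense_iff_topologicalClosure_eq_top.mpr span_mFourier_closure_eq_top
    · rintro _ ⟨k, rfl⟩
      change ∫ p, mFourier k (g p) * D p ∂Measure.pi μ = ∫ x, mFourier k x ∂m
      rw [integral_mFourier_mul_det_velocity hμ, det_integral_velocity_mul_mFourier hμ]
      split_ifs with hk
      · simp [hk, mFourier_zero, m]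
      · exact (integral_mFourier_eq_zero hk).symm
  exact DFunLike.congr_fun hΛI φ

end Equidistribution

/-- Translates by integer vectors of a sum of continua, the `i`-th of which joins the origin to the
`i`-th basis vector, cover the whole space. -/
theorem exists_eq_sum_add_intCast {ι : Type*} [Fintype ι] [DecidableEq ι] {K : Set (ι → ℝ)}
    (hK : IsCompact K) (hc : IsPreconnected K) (h0 : 0 ∈ K) (h1 : ∀ i, Pi.single i 1 ∈ K)
    (x : ι → ℝ) :
    ∃ y : ι → ι → ℝ, (∀ i, y i ∈ K) ∧ ∃ m : ι → ℤ, x = ∑ i, y i + fun j => (m j : ℝ) := by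
  let π : (ι → ℝ) → UnitAddTorus ι := fun x j => (x j : UnitAddCircle)
  have hπ : Continuous π := continuous_pi fun j =>
    (AddCircle.continuous_mk' 1).comp (continuous_apply j)
  have hπs : ∀ y z : ι → ℝ, dist (π y) (π z) ≤ dist y z := fun y z => by
    refine (dist_pi_le_iff dist_nonneg).2 fun j => le_trans ?_ (dist_le_pi_dist y z j)
    rw [dist_eq_norm, dist_eq_norm, ← AddCircle.coe_sub]
    exact QuotientAddGroup.norm_mk_le_norm
  set Q : Set (UnitAddTorus ι) := (fun y : ι → ι → ℝ => ∑ i, π (y i)) '' univ.pi fun _ => K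
  have hQc : IsClosed Q := by
    refine (IsCompact.image (isCompact_univ_pi fun _ => hK) ?_).isClosed
    fun_prop
  have hQne : Q.Nonempty := ⟨_, fun _ => 0, fun _ _ => h0, rfl⟩
  have hle : ∀ ε > 0, ∀ z, Metric.infDist z Q ≤ Fintype.card ι * ε := by
    intro ε hε
    choose μ hμ using fun i => IsPathCurrent.exists_of_isPreconnected hc hε h0 (h1 i)
    have := fun i => (hμ i).isFiniteMeasure
    set φ : UnitAddTorus ι → ℝ := fun z => max (Metric.infDist z Q - Fintype.card ι * ε) 0 with hφ
    have hφc : Continuous φ := by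
      have := Metric.continuous_infDist_pt Q
      fun_prop
    have hz := integral_comp_mul_det_velocity hμ ⟨fun z => (φ z : ℂ), by fun_prop⟩
    have hae : ∀ᵐ p ∂Measure.pi μ, ∀ i, (p i).1 ∈ Metric.thickening ε K :=
      ae_all_iff.2 fun i => Measure.tendsto_eval_ae_ae.eventually (hμ i).ae_mem
    rw [integral_eq_zero_of_ae] at hz
    · have hz' := (integral_eq_zero_iff_of_nonneg (f := φ) (fun z => le_max_right _ _)
        (hφc.integrable_of_hasCompactSupport (HasCompactSupport.of_compactSpace _))).1
        (Complex.ofReal_eq_zero.1 (integral_ofReal.symm.trans hz.symm))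
      have hφ0 : φ = 0 := (hφc.ae_eq_iff_eq _ continuous_zero).1 hz'
      intro z
      have := congrFun hφ0 z
      simpa [hφ] using this
    · filter_upwards [hae] with p hp
      choose y hyK hy using fun i => Metric.mem_thickening_iff.1 (hp i)
      have hyQ : ∑ i, π (y i) ∈ Q := ⟨y, fun i _ => hyK i, rfl⟩
      have : Metric.infDist (∑ i, π (p i).1) Q ≤ Fintype.card ι * ε := by
        refine (Metric.infDist_le_dist_of_mem hyQ).trans ?_
        refine (dist_sum_sum_le _ _ _).trans ?_
        refine (Finset.sum_le_card_nsmul _ _ ε fun i _ => (hπs _ _).trans (hy i).le).trans_eq ?_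
        simp
      have : φ (∑ i, π (p i).1) = 0 := max_eq_right (sub_nonpos.2 this)
      simp only [ContinuousMap.coe_mk, Pi.zero_apply, mul_eq_zero, Complex.ofReal_eq_zero]
      exact Or.inl this
  have hmem : π x ∈ Q := by
    rw [hQc.mem_iff_infDist_zero hQne]
    refine le_antisymm (le_of_forall_pos_le_add fun δ hδ => ?_) Metric.infDist_nonneg
    refine (hle (δ / (Fintype.card ι + 1)) (by positivity) _).trans ?_
    rw [zero_add, mul_div_assoc', div_le_iff₀ (by positivity)]
    nlinarith
  obtain ⟨y, hy, hyx⟩ := hmem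
  refine ⟨y, fun i => hy i trivial, ?_⟩
  have hj : ∀ j, ∃ m : ℤ, (m : ℝ) = x j - ∑ i, y i j := fun j => by
    have h2 : ((x j - ∑ i, y i j : ℝ) : UnitAddCircle) = 0 := by
      have h3 := congrFun hyx j
      simp only [Finset.sum_apply, π] at h3
      rw [AddCircle.coe_sub, sub_eq_zero, ← h3]
      exact (map_sum (QuotientAddGroup.mk' (AddSubgroup.zmultiples (1 : ℝ))) _ _).symm
    obtain ⟨m, hm⟩ := (AddCircle.coe_eq_zero_iff 1).1 h2
    exact ⟨m, by simpa using hm⟩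
  choose m hm using hj
  refine ⟨m, funext fun j => ?_⟩
  simp [hm]

/-- An additive function bounded above on a continuum that joins the origin to each basis vector
is continuous. -/
theorem AddMonoidHom.continuous_of_bddAbove_image {ι : Type*} [Fintype ι] [DecidableEq ι]
    {K : Set (ι → ℝ)} (hK : IsCompact K) (hc : IsPreconnected K) (h0 : 0 ∈ K)
    (h1 : ∀ i, Pi.single i 1 ∈ K) (f : (ι → ℝ) →+ ℝ) (hf : BddAbove (f '' K)) :
    Continuous f := by
  let L : (ι → ℝ) →L[ℝ] ℝ :=
    ∑ i, f (Pi.single i 1) • (ContinuousLinearMap.proj i : (ι → ℝ) →L[ℝ] ℝ)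
  let g : (ι → ℝ) →+ ℝ := f - (L : (ι → ℝ) →+ ℝ)
  have hg : ∀ x, g x = f x - L x := fun x => rfl
  obtain ⟨M, hM⟩ := hf
  obtain ⟨C, hC⟩ := (hK.image L.continuous).bddBelow
  have hgK : ∀ x ∈ K, g x ≤ M - C := fun x hx =>
    sub_le_sub (hM (mem_image_of_mem f hx)) (hC (mem_image_of_mem L hx))
  have hgZ : ∀ m : ι → ℤ, g (fun j => (m j : ℝ)) = 0 := by
    intro m
    have hm : (fun j => (m j : ℝ)) = ∑ i, m i • (Pi.single i 1 : ι → ℝ) := by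
      ext j
      simp [Finset.sum_apply, Pi.single_apply]
    rw [hm, map_sum]
    refine Finset.sum_eq_zero fun i _ => ?_
    rw [map_zsmul, hg]
    simp [L, Pi.single_apply]
  have hbd : ∀ x, g x ≤ Fintype.card ι * (M - C) := by
    intro x
    obtain ⟨y, hy, m, rfl⟩ := exists_eq_sum_add_intCast hK hc h0 h1 x
    rw [map_add, hgZ, add_zero, map_sum]
    refine (Finset.sum_le_card_nsmul _ _ (M - C) fun i _ => hgK _ (hy i)).trans_eq ?_
    simp
  have hg0 : ∀ x, g x ≤ 0 := by
    intro x
    by_contra! hx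
    obtain ⟨N, hN⟩ := exists_nat_gt (Fintype.card ι * (M - C) / g x)
    rw [div_lt_iff₀ hx] at hN
    have := hbd (N • x)
    rw [map_nsmul, nsmul_eq_mul] at this
    linarith
  have hfL : ⇑f = L := by
    ext x
    have h2 := hg0 x
    have h3 := hg0 (-x)
    rw [map_neg] at h3
    linarith [hg x]
  rw [hfL]
  exact L.continuous

theorem additive_continuous_of_bddAbove_on_nonflat_continuum
    {n : ℕ} (hn : 0 < n) (K : Set (Fin n → ℝ))
    (hne : K.Nonempty) (hcomp : IsCompact K) (hconn : IsConnected K)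
    (hflat : affineSpan ℝ K = ⊤)
    (f : (Fin n → ℝ) → ℝ) (hadd : ∀ x y, f (x + y) = f x + f y)
    (hbdd : BddAbove (f '' K)) :
    Continuous f := by
  obtain ⟨p, hp⟩ := hne
  have hspan : ⊤ ≤ Submodule.span ℝ ((· -ᵥ p) '' K) := by
    rw [← vectorSpan_eq_span_vsub_set_right ℝ hp,
      AffineSubspace.vectorSpan_eq_top_of_affineSpan_eq_top ℝ _ _ hflat]
  let b₀ := Module.Basis.ofSpan hspan
  let b : Module.Basis (Fin n) ℝ (Fin n → ℝ) := b₀.reindex (b₀.indexEquiv (Pi.basisFun ℝ (Fin n)))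
  have hb : ∀ i, b i ∈ (· -ᵥ p) '' K := fun i =>
    Module.Basis.ofSpan_subset hspan (by simp [b, b₀])
  let e := b.equivFun.toContinuousLinearEquiv
  let F : (Fin n → ℝ) →+ ℝ := AddMonoidHom.mk' f hadd
  have heb : ∀ i, e (b i) = Pi.single i 1 := fun i => by
    ext j
    simp [e, Pi.single_apply, eq_comm]
  have hmap : Continuous fun x => e (x - p) := by fun_prop
  have key := AddMonoidHom.continuous_of_bddAbove_image (K := (fun x => e (x - p)) '' K)
    (hcomp.image hmap) (hconn.isPreconnected.image _ hmap.continuousOn) ⟨p, hp, by simp⟩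
    (fun i => ?_) (F.comp (e.symm : (Fin n → ℝ) →+ (Fin n → ℝ))) ?_
  · have : f = fun x => F (e.symm (e x)) := by
      ext x
      simp [F]
    rw [this]
    exact key.comp e.continuous
  · obtain ⟨x, hx, hxb⟩ := hb i
    exact ⟨x, hx, by rw [← heb, ← hxb]; rfl⟩
  · obtain ⟨M, hM⟩ := hbdd
    refine ⟨M - F p, ?_⟩
    rintro _ ⟨_, ⟨x, hx, rfl⟩, rfl⟩
    have : F (e.symm (e (x - p))) = F x - F p := by
      rw [e.symm_apply_apply, map_sub]
    exact this.trans_le (sub_le_sub_right (hM (mem_image_of_mem f hx)) _)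
end

section
/- Let n ≥ 1 and let K be a nonempty subset of ℝⁿ whose affine span is a proper subset of ℝⁿ (i.e., K is flat). Then there exists a discontinuous additive function f : ℝⁿ → ℝ that is constant on K; in particular f(K) is a bounded subset of ℝ. -/
theorem exists_discontinuous_addMonoidHom_real : ∃ a : ℝ →+ ℝ, ¬ Continuous a := by
  have hlt : Submodule.span ℚ {(1 : ℝ)} < ⊤ := by
    refine lt_top_iff_ne_top.2 fun h => irrational_sqrt_two ?_
    obtain ⟨q, hq⟩ := Submodule.mem_span_singleton.1 (h ▸ Submodule.mem_top (x := √2))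
    exact ⟨q, by simpa [Rat.smul_def] using hq⟩
  obtain ⟨g, hg, hker⟩ := Submodule.exists_le_ker_of_lt_top _ hlt
  have hg1 : g 1 = 0 := hker (Submodule.mem_span_singleton_self 1)
  refine ⟨(Rat.castHom ℝ).toAddMonoidHom.comp g.toAddMonoidHom, fun hc => hg ?_⟩
  ext t
  simpa [hg1] using map_real_smul _ hc t (1 : ℝ)

theorem exists_linearMap_ne_zero_constant_on_of_affineSpan_ne_top {V : Type*} [AddCommGroup V]
    [Module ℝ V] {K : Set V} (hne : K.Nonempty) (hflat : affineSpan ℝ K ≠ ⊤) :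
    ∃ φ : V →ₗ[ℝ] ℝ, φ ≠ 0 ∧ ∀ x ∈ K, ∀ y ∈ K, φ x = φ y := by
  have hlt : (affineSpan ℝ K).direction < ⊤ := lt_top_iff_ne_top.2 fun h =>
    hflat ((AffineSubspace.direction_eq_top_iff_of_nonempty
      ((affineSpan_nonempty ℝ).2 hne)).1 h)
  obtain ⟨φ, hφ, hker⟩ := Submodule.exists_le_ker_of_lt_top _ hlt
  refine ⟨φ, hφ, fun x hx y hy => sub_eq_zero.1 ?_⟩
  rw [← map_sub]
  exact hker (AffineSubspace.vsub_mem_direction (subset_affineSpan ℝ K hx)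
    (subset_affineSpan ℝ K hy))

theorem exists_discontinuous_additive_constant_on_flat_set
    {n : ℕ} (hn : 0 < n) (K : Set (Fin n → ℝ))
    (hne : K.Nonempty) (hflat : affineSpan ℝ K ≠ ⊤) :
    ∃ f : (Fin n → ℝ) → ℝ, (∀ x y, f (x + y) = f x + f y) ∧
      ¬ Continuous f ∧ ∃ c : ℝ, ∀ x ∈ K, f x = c := by
  obtain ⟨a, ha⟩ := exists_discontinuous_addMonoidHom_real
  obtain ⟨φ, hφ, hconst⟩ := exists_linearMap_ne_zero_constant_on_of_affineSpan_ne_top hne hflat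
  obtain ⟨v, hv⟩ := LinearMap.surjective hφ 1
  obtain ⟨x₀, hx₀⟩ := hne
  refine ⟨fun x => a (φ x), fun x y => by simp, fun hc => ha ?_, a (φ x₀),
    fun x hx => congrArg a (hconst x hx x₀ hx₀)⟩
  have hline : Continuous fun t : ℝ => t • v := by fun_prop
  simpa [Function.comp_def, hv] using hc.comp hline
end
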